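/- arXiv:math/0009008 — 4 statements merged into one kernel-verified Lean document; each statement's English description precedes it below -/
import Mathlib

section
/- If KG₁ has a filtered multiplicative K-basis B₁ and KG₂ has a filtered multiplicative K-basis B₂, where G₁ and G₂ are finite groups and K is a field, then the set {b₁ ⊗ b₂ : b₁ ∈ B₁, b₂ ∈ B₂} (identified with B₁ × B₂ inside K[G₁ × G₂] ≅ KG₁ ⊗ KG₂) is a filtered multiplicative K-basis of K[G₁ × G₂]. -/
/-- The Jacobson radical of a ring, as an ideal. -/
def ringRad (A : Type*) [Ring A] : Ideal A := (⊥ : Ideal A).jacobson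

/-- `B` is a filtered multiplicative `K`-basis of the `K`-algebra `A`:
it is a `K`-basis, products of basis elements are `0` or again basis elements,
and `B ∩ rad A` is a `K`-basis of the Jacobson radical `rad A`. -/
def IsFilteredMulBasis (K : Type*) {A : Type*} [Field K] [Ring A] [Algebra K A]
    (B : Set A) : Prop :=
  LinearIndependent K ((↑) : B → A) ∧ Submodule.span K B = ⊤ ∧
  (∀ b₁ ∈ B, ∀ b₂ ∈ B, b₁ * b₂ = 0 ∨ b₁ * b₂ ∈ B) ∧
  LinearIndependent K ((↑) : ↥(B ∩ (ringRad A : Set A)) → A) ∧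
  Submodule.span K (B ∩ (ringRad A : Set A)) = Submodule.restrictScalars K (ringRad A)

open MonoidAlgebra

lemma fmb_nil_of_mem {K A : Type*} [Field K] [Ring A] [Algebra K A] [FiniteDimensional K A] :
    ∃ n : ℕ, (ringRad A) ^ n = ⊥ := by
  have := IsArtinianRing.of_finite K A
  have h := IsSemiprimaryRing.isNilpotent (R := A)
  rw [← Ideal.jacobson_bot] at h
  exact h

lemma fmb_isNilpotent {K A : Type*} [Field K] [Ring A] [Algebra K A] [FiniteDimensional K A]
    {a : A} (ha : a ∈ ringRad A) : IsNilpotent a := by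
  obtain ⟨n, hn⟩ := fmb_nil_of_mem (K := K) (A := A)
  have : a ^ n ∈ (ringRad A) ^ n := Ideal.pow_mem_pow ha n
  rw [hn] at this
  exact ⟨n, by simpa using this⟩

lemma fmb_mem_rad {A : Type*} [Ring A] {a : A} (h : ∀ y : A, IsNilpotent (y * a)) :
    a ∈ ringRad A := by
  unfold ringRad
  rw [Ideal.mem_jacobson_iff]
  intro y
  obtain ⟨u, hu⟩ := (h y).isUnit_one_add
  refine ⟨(↑u⁻¹ : A), ?_⟩
  have : (↑u⁻¹ : A) * (1 + y * a) = 1 := by rw [← hu]; simp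
  rw [mul_add] at this
  simp only [Submodule.mem_bot]
  rw [mul_assoc, ← this]; simp; abel

lemma fmb_mul_mem_rad {A : Type*} [Ring A] {a : A} (h : a ∈ ringRad A) (y : A) :
    a * y ∈ ringRad A := by
  unfold ringRad at *
  rw [Ideal.jacobson_bot] at *
  exact Ideal.mul_mem_right _ _ h

lemma fmb_descent {L G : Type*} [Field L] (σ : L →+* L)
    (W : Submodule L (MonoidAlgebra L G)) (hW : ∀ w ∈ W, MonoidAlgebra.map (σ : L →+ L) w ∈ W) :
    W ≤ Submodule.span L {w | w ∈ W ∧ MonoidAlgebra.map (σ : L →+ L) w = w} := by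
  classical
  suffices H : ∀ n : ℕ, ∀ w ∈ W, w.coeff.support.card = n →
      w ∈ Submodule.span L {w | w ∈ W ∧ MonoidAlgebra.map (σ : L →+ L) w = w} from
    fun w hw => H _ w hw rfl
  intro n
  induction n using Nat.strong_induction_on with
  | _ n ih =>
  intro w hw hn
  by_cases hw0 : w = 0
  · subst hw0; exact zero_mem _
  have hex : ∃ m : ℕ, ∃ v ∈ W, v ≠ 0 ∧ v.coeff.support ⊆ w.coeff.support ∧
      v.coeff.support.card = m := ⟨_, w, hw, hw0, subset_rfl, rfl⟩
  obtain ⟨v, hv, hv0, hvs, hvc⟩ := Nat.find_spec hex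
  have hmin := fun m hm => Nat.find_min hex (m := m) hm
  rw [← hvc] at hmin
  obtain ⟨g, hg⟩ : ∃ g, v.coeff g ≠ 0 := by
    by_contra! hc
    exact hv0 (by ext g; simpa using hc g)
  set u := (v.coeff g)⁻¹ • v with hu
  have huW : u ∈ W := W.smul_mem _ hv
  have hug : u.coeff g = 1 := by simp [hu, hg]
  have hus : ∀ x, v.coeff x = 0 → u.coeff x = 0 := by
    intro x hx; simp [hu, hx]
  have hfix : MonoidAlgebra.map (σ : L →+ L) u = u := by
    by_contra hne
    have hs : (MonoidAlgebra.map (σ : L →+ L) u - u).coeff.support ⊆ v.coeff.support.erase g := by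
      intro x hx
      rw [Finset.mem_erase, Finsupp.mem_support_iff]
      rw [Finsupp.mem_support_iff] at hx
      constructor
      · rintro rfl
        apply hx; simp [hug]
      · intro h0
        apply hx; simp [hus x h0]
    have hlt : (MonoidAlgebra.map (σ : L →+ L) u - u).coeff.support.card
        < v.coeff.support.card :=
      lt_of_le_of_lt (Finset.card_le_card hs)
        (Finset.card_erase_lt_of_mem (by simpa using hg))
    exact hmin _ hlt ⟨_, W.sub_mem (hW u huW) huW, sub_ne_zero.2 hne,
      (hs.trans (Finset.erase_subset _ _)).trans hvs, rfl⟩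
  have hgw : g ∈ w.coeff.support := hvs (by simpa using hg)
  have hs : (w - w.coeff g • u).coeff.support ⊆ w.coeff.support.erase g := by
    intro x hx
    rw [Finset.mem_erase, Finsupp.mem_support_iff]
    rw [Finsupp.mem_support_iff] at hx
    constructor
    · rintro rfl
      apply hx; simp [hug]
    · intro h0
      apply hx
      have : v.coeff x = 0 := by
        by_contra h
        exact (Finsupp.mem_support_iff.1 (hvs (Finsupp.mem_support_iff.2 h))) h0
      simp [hus x this, h0]
  have h1 := ih _ (hn ▸ lt_of_le_of_lt (Finset.card_le_card hs)
    (Finset.card_erase_lt_of_mem hgw)) _ (W.sub_mem hw (W.smul_mem (w.coeff g) huW)) rfl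
  have h2 : u ∈ Submodule.span L {w | w ∈ W ∧ MonoidAlgebra.map (σ : L →+ L) w = w} :=
    Submodule.subset_span ⟨huW, hfix⟩
  have := add_mem h1 (Submodule.smul_mem _ (w.coeff g) h2)
  simpa using this

lemma fmb_rad_equiv {A : Type*} [Ring A] (e : A ≃+* A) {a : A} (h : a ∈ ringRad A) :
    e a ∈ ringRad A := by
  unfold ringRad at *
  rw [Ideal.mem_jacobson_iff] at *
  intro y
  obtain ⟨z, hz⟩ := h (e.symm y)
  refine ⟨e z, ?_⟩
  have := congrArg e (Ideal.mem_bot.1 hz)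
  simpa using this

lemma fmb_rad_le {K L G : Type*} [Field K] [Field L] [IsAlgClosed L] [Algebra K L] [Group G]
    [Finite G] :
    Submodule.restrictScalars L (ringRad (MonoidAlgebra L G)) ≤
      Submodule.span L (MonoidAlgebra.map (algebraMap K L : K →+ L) ''
        (ringRad (MonoidAlgebra K G) : Set (MonoidAlgebra K G))) := by
  have : FiniteDimensional L (MonoidAlgebra L G) := inferInstance
  obtain ⟨p, hp⟩ := CharP.exists L
  rcases CharP.char_is_prime_or_zero L p with hpp | rfl
  · have := Fact.mk hpp
    refine (fmb_descent (frobenius L p) _ ?_).trans (Submodule.span_mono ?_)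
    · intro w hw
      exact fmb_rad_equiv (MonoidAlgebra.mapRingEquiv G (frobeniusEquiv L p)) hw
    · rintro w ⟨hw, hfix⟩
      have hc : w ∈ Set.range (MonoidAlgebra.map (M := G) (algebraMap K L : K →+ L)) := by
        rw [MonoidAlgebra.range_map]
        intro g
        have h1 := congrArg (fun z => z.coeff g) hfix
        simp [frobenius_def] at h1
        have h2 := (Subfield.mem_bot_iff_pow_eq_self (F := L) (p := p)).2 h1
        have h3 : (⊥ : Subfield L) ≤ (algebraMap K L).fieldRange := bot_le
        exact h3 h2
      obtain ⟨v, rfl⟩ := hc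
      refine ⟨v, fmb_mem_rad fun y => ?_, rfl⟩
      have h1 : IsNilpotent (MonoidAlgebra.mapRingHom G (algebraMap K L) (y * v)) := by
        rw [map_mul]
        exact fmb_isNilpotent (K := L) (Ideal.mul_mem_left _ _ hw)
      exact (IsNilpotent.map_iff
        (MonoidAlgebra.map_injective _ (algebraMap K L).injective)).1 h1
  · have := CharP.charP_to_charZero L
    have : NeZero (Nat.card G : L) := ⟨by simp [Nat.card_pos.ne']⟩
    have : ringRad (MonoidAlgebra L G) = ⊥ := by
      unfold ringRad
      rw [Ideal.jacobson_bot]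
      exact IsSemisimpleModule.jacobson_eq_bot _ _
    rw [this]
    intro x hx
    have : x = 0 := by simpa using hx
    subst this
    exact zero_mem _

/-- Images in `R` of radical elements of a tensor factor are in the radical. -/
lemma fmb_factor {K A R : Type*} [Field K] [Ring A] [Ring R] [Algebra K A] [Algebra K R]
    [FiniteDimensional K A] (f : A →ₐ[K] R) (S : Subalgebra K R)
    (hcomm : ∀ a, ∀ s ∈ S, Commute (f a) s)
    (htop : S.toSubmodule * f.range.toSubmodule = ⊤) {a : A} (ha : a ∈ ringRad A) :
    f a ∈ ringRad R := by
  obtain ⟨n, hn⟩ := fmb_nil_of_mem (K := K) (A := A)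
  set I : Submodule K A := Submodule.restrictScalars K (ringRad A) with hI
  have hIn : ∀ m : ℕ, I ^ (m + 1) ≤ Submodule.restrictScalars K ((ringRad A) ^ (m + 1)) := by
    intro m
    induction m with
    | zero => simp [hI, Submodule.pow_one]
    | succ m ih =>
      rw [pow_succ]
      refine Submodule.mul_le.2 fun x hx y hy => ?_
      have h1 := ih hx
      simp only [Submodule.restrictScalars_mem] at h1 ⊢
      rw [Submodule.pow_succ]
      exact Ideal.mul_mem_mul h1 hy
  have hI0 : I ^ (n + 1) = ⊥ := by
    rw [eq_bot_iff]
    refine (hIn n).trans ?_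
    rw [Submodule.pow_succ, hn]
    intro x hx
    simpa using hx
  set M : Submodule K R := I.map f.toLinearMap with hM
  have hMn : M ^ (n + 1) = ⊥ := by
    rw [hM, ← Submodule.map_pow, hI0, Submodule.map_bot]
  have hc : Commute S.toSubmodule M := by
    refine Submodule.mul_comm_of_commute ?_
    rintro s hs _ ⟨b, -, rfl⟩
    exact (hcomm b s hs).symm
  have hSM : (S.toSubmodule * M) ^ (n + 1) = ⊥ := by
    rw [hc.mul_pow, hMn, Submodule.mul_bot]
  refine fmb_mem_rad fun y => ⟨n + 1, ?_⟩
  have hy : y * f a ∈ S.toSubmodule * M := by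
    have h1 : y * f a ∈ (S.toSubmodule * f.range.toSubmodule) * M :=
      Submodule.mul_mem_mul (htop ▸ Submodule.mem_top) ⟨a, ha, rfl⟩
    rw [mul_assoc] at h1
    refine mul_le_mul_right (a := S.toSubmodule) ?_ h1
    refine Submodule.mul_le.2 ?_
    rintro _ ⟨b, rfl⟩ _ ⟨c, hc, rfl⟩
    exact ⟨b * c, Ideal.mul_mem_left _ b hc, by simp⟩
  have := Submodule.pow_mem_pow _ hy (n + 1)
  rw [hSM] at this
  simpa using this

lemma fmb_finite {K G : Type*} [Field K] [Group G] [Finite G] {B : Set (MonoidAlgebra K G)}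
    (hB : IsFilteredMulBasis K B) : Finite B := by
  have : FiniteDimensional K (MonoidAlgebra K G) := inferInstance
  exact hB.1.finite

lemma fmb_finrank (K G : Type*) [Field K] [Group G] [Finite G] :
    Module.finrank K (MonoidAlgebra K G) = Nat.card G := by
  have := Fintype.ofFinite G
  have h := Module.finrank_eq_card_basis (MonoidAlgebra.basis G K)
  simpa using h

lemma fmb_card {K G : Type*} [Field K] [Group G] [Finite G] {B : Set (MonoidAlgebra K G)}
    [Fintype B] (hB : IsFilteredMulBasis K B) : Fintype.card B = Nat.card G := by
  have := Module.finrank_eq_card_basis (Module.Basis.mk hB.1 (by simp [hB.2.1]))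
  rw [← this, fmb_finrank]

lemma fmb_span_top (K G : Type*) [Field K] [Group G] (W : Submodule K (MonoidAlgebra K G))
    (h : ∀ g, MonoidAlgebra.single g (1 : K) ∈ W) : W = ⊤ := by
  rw [eq_top_iff]
  intro x _
  induction x using MonoidAlgebra.induction_linear with
  | zero => exact zero_mem _
  | add f g hf hg => exact add_mem (hf trivial) (hg trivial)
  | single g r =>
    have := W.smul_mem r (h g)
    simpa using this

lemma fmb_map_indep {K L G : Type*} [Field K] [Field L] [Algebra K L] [Group G]
    [Finite G] {B : Set (MonoidAlgebra K G)} (hB : IsFilteredMulBasis K B) :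
    LinearIndependent L
      (fun b : B => MonoidAlgebra.map (algebraMap K L : K →+ L) (b : MonoidAlgebra K G)) := by
  have := fmb_finite hB
  have := Fintype.ofFinite B
  refine linearIndependent_of_top_le_span_of_card_eq_finrank ?_ ?_
  · rw [top_le_iff]
    apply fmb_span_top
    intro g
    have key : ∀ x ∈ Submodule.span K B, MonoidAlgebra.map (algebraMap K L : K →+ L) x ∈
        Submodule.span L (Set.range (fun b : B => MonoidAlgebra.map (algebraMap K L : K →+ L)
          (b : MonoidAlgebra K G))) := by
      intro x hx
      induction hx using Submodule.span_induction with
      | mem x hx => exact Submodule.subset_span ⟨⟨x, hx⟩, rfl⟩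
      | zero => rw [MonoidAlgebra.map_zero]; exact zero_mem _
      | add x y _ _ h1 h2 => rw [MonoidAlgebra.map_add]; exact add_mem h1 h2
      | smul a x _ h =>
        have : MonoidAlgebra.map (algebraMap K L : K →+ L) (a • x) =
          algebraMap K L a • MonoidAlgebra.map (algebraMap K L : K →+ L) x := by
          ext; simp [Algebra.smul_def]
        rw [this]; exact Submodule.smul_mem _ _ h
    have := key (MonoidAlgebra.single g 1) (by rw [hB.2.1]; trivial)
    simpa using this
  · rw [fmb_card hB, fmb_finrank]

lemma fmb_rep (L G : Type*) [Field L] [IsAlgClosed L] [Group G] [Finite G] :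
    ∃ (n : ℕ) (d : Fin n → ℕ) (ρ : ∀ i, MonoidAlgebra L G →ₐ[L] Matrix (Fin (d i)) (Fin (d i)) L),
      (∀ i, Function.Surjective (ρ i)) ∧ ∀ x, (∀ i, ρ i x = 0) → x ∈ ringRad (MonoidAlgebra L G) := by
  have := IsArtinianRing.of_finite L (MonoidAlgebra L G)
  obtain ⟨n, d, -, ⟨e⟩⟩ := IsSemisimpleRing.exists_algEquiv_pi_matrix_of_isAlgClosed L
    (MonoidAlgebra L G ⧸ Ring.jacobson (MonoidAlgebra L G))
  refine ⟨n, d, fun i => (Pi.evalAlgHom L _ i).comp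
    (e.toAlgHom.comp (Ideal.Quotient.mkₐ L (Ring.jacobson (MonoidAlgebra L G)))), ?_, ?_⟩
  · intro i
    exact (Function.surjective_eval i).comp (e.surjective.comp Ideal.Quotient.mk_surjective)
  · intro x hx
    unfold ringRad
    rw [Ideal.jacobson_bot, ← Ideal.Quotient.eq_zero_iff_mem]
    apply e.injective
    rw [map_zero]
    funext i
    exact hx i

lemma fmb_pack {K : Type*} (L : Type*) {G : Type*} [Field K] [Field L] [IsAlgClosed L] [Algebra K L]
    [Group G] [Finite G] {B : Set (MonoidAlgebra K G)} [Fintype B] (hB : IsFilteredMulBasis K B) :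
    ∃ (n : ℕ) (d : Fin n → ℕ) (ρ : ∀ i, MonoidAlgebra K G →ₐ[K] Matrix (Fin (d i)) (Fin (d i)) L),
      (∀ i, Submodule.span L (Set.range fun g => ρ i (MonoidAlgebra.single g 1)) = ⊤) ∧
      ∀ l : B → L, (∀ i, ∑ b : B, l b • ρ i b = 0) →
        ∀ b : B, (b : MonoidAlgebra K G) ∉ ringRad (MonoidAlgebra K G) → l b = 0 := by
  obtain ⟨n, d, ρ, hs, hr⟩ := fmb_rep L G
  refine ⟨n, d, fun i => ((ρ i).restrictScalars K).comp
    (MonoidAlgebra.mapAlgHom G (Algebra.ofId K L)), ?_, ?_⟩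
  · intro i
    have h1 : Submodule.span L (Set.range fun g : G => MonoidAlgebra.single g (1 : L)) = ⊤ :=
      fmb_span_top _ _ _ fun g => Submodule.subset_span ⟨g, rfl⟩
    have h2 := congrArg (Submodule.map (ρ i).toLinearMap) h1
    rw [Submodule.map_span, Submodule.map_top, LinearMap.range_eq_top.2 (hs i), ← Set.range_comp]
      at h2
    rw [← h2]
    congr 2
    funext g
    simp
  · intro l hl b hb
    set m : MonoidAlgebra K G → MonoidAlgebra L G := MonoidAlgebra.map (algebraMap K L : K →+ L)
    have h1 : ∑ b : B, l b • m b ∈ ringRad (MonoidAlgebra L G) := by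
      apply hr
      intro i
      rw [map_sum]
      simp_rw [map_smul]
      exact hl i
    have h2 : ∑ b : B, l b • m b ∈ Submodule.span L
        ((fun b : B => m b) '' {b | (b : MonoidAlgebra K G) ∈ ringRad (MonoidAlgebra K G)}) := by
      refine Submodule.span_le.2 ?_ (fmb_rad_le (K := K) h1)
      rintro _ ⟨x, hx, rfl⟩
      have hx' : x ∈ Submodule.span K (B ∩ (ringRad (MonoidAlgebra K G) : Set _)) := by
        rw [hB.2.2.2.2]; exact hx
      clear hx
      induction hx' using Submodule.span_induction with
      | mem x hx => exact Submodule.subset_span ⟨⟨x, hx.1⟩, hx.2, rfl⟩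
      | zero => rw [MonoidAlgebra.map_zero]; exact zero_mem _
      | add x y _ _ h1 h2 => rw [MonoidAlgebra.map_add]; exact add_mem h1 h2
      | smul a x _ h =>
        have : MonoidAlgebra.map (algebraMap K L : K →+ L) (a • x) =
          algebraMap K L a • MonoidAlgebra.map (algebraMap K L : K →+ L) x := by
          ext; simp [Algebra.smul_def]
        rw [this]; exact Submodule.smul_mem _ _ h
    have hind := fmb_map_indep (L := L) hB
    obtain ⟨f, hf, hfe⟩ := (Finsupp.mem_span_image_iff_linearCombination L).1 h2
    have h3 : Finsupp.linearCombination L (fun b : B => m b) (Finsupp.equivFunOnFinite.symm l) =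
        Finsupp.linearCombination L (fun b : B => m b) f := by
      rw [hfe, Finsupp.linearCombination_apply, Finsupp.sum_fintype _ _ (by simp)]
      simp
    have h4 := DFunLike.congr_fun (hind h3) b
    rw [(Finsupp.mem_supported' L f).1 hf b hb] at h4
    simpa using h4

open Kronecker in
/-- The outer tensor product of two matrix representations kills the radical. -/
lemma fmb_kron {K L G₁ G₂ : Type*} [Field K] [Field L] [Algebra K L] [Group G₁] [Group G₂]
    [Finite G₁] [Finite G₂] {n m : ℕ}
    (ρ : MonoidAlgebra K G₁ →ₐ[K] Matrix (Fin n) (Fin n) L)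
    (τ : MonoidAlgebra K G₂ →ₐ[K] Matrix (Fin m) (Fin m) L)
    (hρ : Submodule.span L (Set.range fun g => ρ (MonoidAlgebra.single g 1)) = ⊤)
    (hτ : Submodule.span L (Set.range fun g => τ (MonoidAlgebra.single g 1)) = ⊤) :
    ∃ Φ : MonoidAlgebra K (G₁ × G₂) →ₐ[K] Matrix (Fin n × Fin m) (Fin n × Fin m) L,
      (∀ a b, Φ (MonoidAlgebra.mapDomainAlgHom K K (MonoidHom.inl G₁ G₂) a *
            MonoidAlgebra.mapDomainAlgHom K K (MonoidHom.inr G₁ G₂) b) = ρ a ⊗ₖ τ b) ∧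
      ∀ x ∈ ringRad (MonoidAlgebra K (G₁ × G₂)), Φ x = 0 := by
  let φ : G₁ × G₂ →* Matrix (Fin n × Fin m) (Fin n × Fin m) L :=
    { toFun := fun g => ρ (MonoidAlgebra.single g.1 1) ⊗ₖ τ (MonoidAlgebra.single g.2 1)
      map_one' := by
        simp [← MonoidAlgebra.one_def]
      map_mul' := fun g h => by
        rw [← Matrix.mul_kronecker_mul, ← map_mul, ← map_mul]
        simp }
  have hφ : ∀ g, φ g = ρ (MonoidAlgebra.single g.1 1) ⊗ₖ τ (MonoidAlgebra.single g.2 1) :=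
    fun g => rfl
  let Φ := MonoidAlgebra.lift K (Matrix (Fin n × Fin m) (Fin n × Fin m) L) (G₁ × G₂) φ
  have hΦ : ∀ g, Φ (MonoidAlgebra.single g 1) = φ g := fun g => by simp [Φ]
  have key : ∀ a b, Φ (MonoidAlgebra.mapDomainAlgHom K K (MonoidHom.inl G₁ G₂) a *
            MonoidAlgebra.mapDomainAlgHom K K (MonoidHom.inr G₁ G₂) b) = ρ a ⊗ₖ τ b := by
    intro a b
    induction a using MonoidAlgebra.induction_linear with
    | zero => simp
    | add f g hf hg => rw [map_add, add_mul, map_add, hf, hg, map_add, Matrix.add_kronecker]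
    | single g r =>
      induction b using MonoidAlgebra.induction_linear with
      | zero => simp
      | add f g hf hg => rw [map_add, mul_add, map_add, hf, hg, map_add, Matrix.kronecker_add]
      | single h s =>
        have h1 : MonoidAlgebra.single g r = r • MonoidAlgebra.single g (1 : K) := by simp
        have h2 : MonoidAlgebra.single h s = s • MonoidAlgebra.single h (1 : K) := by simp
        rw [h1, h2, map_smul, map_smul, map_smul, map_smul, smul_mul_smul_comm, map_smul,
          Matrix.smul_kronecker, Matrix.kronecker_smul, smul_smul]
        congr 1
        have := hΦ (g, h)
        rw [hφ] at this
        rw [← this]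
        simp
  refine ⟨Φ, key, fun x hx => ?_⟩
  have ht : ∀ g, Matrix.trace (Φ x * φ g) = 0 := by
    intro g
    rw [← hΦ, ← map_mul]
    have h1 : IsNilpotent (x * MonoidAlgebra.single g 1) :=
      fmb_isNilpotent (K := K) (fmb_mul_mem_rad hx _)
    exact (Matrix.isNilpotent_trace_of_isNilpotent (h1.map Φ)).eq_zero
  have ht2 : ∀ Y Z, Matrix.trace (Φ x * (Y ⊗ₖ Z)) = 0 := by
    intro Y Z
    have hY : Y ∈ Submodule.span L (Set.range fun g => ρ (MonoidAlgebra.single g 1)) :=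
      hρ ▸ Submodule.mem_top
    have hZ : Z ∈ Submodule.span L (Set.range fun g => τ (MonoidAlgebra.single g 1)) :=
      hτ ▸ Submodule.mem_top
    induction hY using Submodule.span_induction with
    | zero => simp
    | add a b _ _ h1 h2 => rw [Matrix.add_kronecker, mul_add, Matrix.trace_add, h1, h2, add_zero]
    | smul r a _ h => rw [Matrix.smul_kronecker, mul_smul_comm, Matrix.trace_smul, h, smul_zero]
    | mem y hy =>
      obtain ⟨g, rfl⟩ := hy
      induction hZ using Submodule.span_induction with
      | zero => simp
      | add a b _ _ h1 h2 => rw [Matrix.kronecker_add, mul_add, Matrix.trace_add, h1, h2, add_zero]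
      | smul r a _ h => rw [Matrix.kronecker_smul, mul_smul_comm, Matrix.trace_smul, h, smul_zero]
      | mem z hz =>
        obtain ⟨h, rfl⟩ := hz
        exact ht (g, h)
  ext ⟨i, k⟩ ⟨j, l⟩
  have := ht2 (Matrix.single j i 1) (Matrix.single l k 1)
  rw [Matrix.single_kronecker_single, Matrix.trace_mul_single] at this
  simpa using this

theorem stmt_4 {K : Type*} [Field K] {G₁ G₂ : Type*} [Group G₁] [Group G₂]
    [Finite G₁] [Finite G₂]
    (B₁ : Set (MonoidAlgebra K G₁)) (B₂ : Set (MonoidAlgebra K G₂))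
    (hB₁ : IsFilteredMulBasis K B₁) (hB₂ : IsFilteredMulBasis K B₂) :
    IsFilteredMulBasis K
      {x : MonoidAlgebra K (G₁ × G₂) | ∃ b₁ ∈ B₁, ∃ b₂ ∈ B₂,
        x = MonoidAlgebra.mapDomainAlgHom K K (MonoidHom.inl G₁ G₂) b₁ *
            MonoidAlgebra.mapDomainAlgHom K K (MonoidHom.inr G₁ G₂) b₂} := by
  classical
  set C := {x : MonoidAlgebra K (G₁ × G₂) | ∃ b₁ ∈ B₁, ∃ b₂ ∈ B₂,
        x = MonoidAlgebra.mapDomainAlgHom K K (MonoidHom.inl G₁ G₂) b₁ *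
            MonoidAlgebra.mapDomainAlgHom K K (MonoidHom.inr G₁ G₂) b₂} with hCdef
  set f₁ := MonoidAlgebra.mapDomainAlgHom K K (MonoidHom.inl G₁ G₂) with hf₁
  set f₂ := MonoidAlgebra.mapDomainAlgHom K K (MonoidHom.inr G₁ G₂) with hf₂
  have := fmb_finite hB₁
  have := fmb_finite hB₂
  have := Fintype.ofFinite B₁
  have := Fintype.ofFinite B₂
  have hcomm : ∀ a b, Commute (f₁ a) (f₂ b) := by
    intro a b
    induction a using MonoidAlgebra.induction_linear with
    | zero => simp
    | add f g hf hg => rw [map_add]; exact hf.add_left hg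
    | single g r =>
      induction b using MonoidAlgebra.induction_linear with
      | zero => simp
      | add f g hf hg => rw [map_add]; exact hf.add_right hg
      | single h s => simp [Commute, SemiconjBy, hf₁, hf₂, mul_comm]
  have htop : f₁.range.toSubmodule * f₂.range.toSubmodule = ⊤ := by
    apply fmb_span_top
    rintro ⟨g, h⟩
    have : MonoidAlgebra.single (g, h) (1 : K) =
        f₁ (MonoidAlgebra.single g 1) * f₂ (MonoidAlgebra.single h 1) := by
      simp [hf₁, hf₂]
    rw [this]
    exact Submodule.mul_mem_mul ⟨_, rfl⟩ ⟨_, rfl⟩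
  have htop' : f₂.range.toSubmodule * f₁.range.toSubmodule = ⊤ := by
    rw [← htop]
    refine Submodule.mul_comm_of_commute ?_
    rintro _ ⟨a, rfl⟩ _ ⟨b, rfl⟩
    exact (hcomm b a).symm
  have hr₁ : ∀ a ∈ ringRad (MonoidAlgebra K G₁), f₁ a ∈ ringRad (MonoidAlgebra K (G₁ × G₂)) := by
    intro a ha
    refine fmb_factor f₁ f₂.range ?_ htop' ha
    rintro a _ ⟨b, rfl⟩
    exact hcomm a b
  have hr₂ : ∀ a ∈ ringRad (MonoidAlgebra K G₂), f₂ a ∈ ringRad (MonoidAlgebra K (G₁ × G₂)) := by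
    intro a ha
    refine fmb_factor f₂ f₁.range ?_ htop ha
    rintro a _ ⟨b, rfl⟩
    exact (hcomm b a).symm
  set F : B₁ × B₂ → MonoidAlgebra K (G₁ × G₂) := fun p => f₁ p.1 * f₂ p.2 with hF
  have hCF : C = Set.range F := by
    ext x
    constructor
    · rintro ⟨a, ha, b, hb, rfl⟩
      exact ⟨(⟨a, ha⟩, ⟨b, hb⟩), rfl⟩
    · rintro ⟨⟨a, b⟩, rfl⟩
      exact ⟨a, a.2, b, b.2, rfl⟩
  have hspan : Submodule.span K C = ⊤ := by
    have h1 : f₁.range.toSubmodule = Submodule.span K (f₁ '' B₁) := by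
      have := Submodule.map_span f₁.toLinearMap B₁
      rw [hB₁.2.1, Submodule.map_top] at this
      exact this
    have h2 : f₂.range.toSubmodule = Submodule.span K (f₂ '' B₂) := by
      have := Submodule.map_span f₂.toLinearMap B₂
      rw [hB₂.2.1, Submodule.map_top] at this
      exact this
    rw [← htop, h1, h2, Submodule.span_mul_span]
    congr 1
    ext x
    constructor
    · rintro ⟨a, ha, b, hb, rfl⟩
      exact Set.mul_mem_mul ⟨a, ha, rfl⟩ ⟨b, hb, rfl⟩
    · rintro ⟨_, ⟨a, ha, rfl⟩, _, ⟨b, hb, rfl⟩, rfl⟩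
      exact ⟨a, ha, b, hb, rfl⟩
  have hind : LinearIndependent K F := by
    refine linearIndependent_of_top_le_span_of_card_eq_finrank ?_ ?_
    · rw [← hCF, hspan]
    · rw [Fintype.card_prod, fmb_card hB₁, fmb_card hB₂, fmb_finrank, Nat.card_prod]
  have hindC : LinearIndependent K ((↑) : C → MonoidAlgebra K (G₁ × G₂)) := by
    rw [hCF]
    exact hind.linearIndepOn_id
  refine ⟨hindC, hspan, ?_, ?_, ?_⟩
  · rintro _ ⟨a, ha, b, hb, rfl⟩ _ ⟨a', ha', b', hb', rfl⟩
    have h1 : f₁ a * f₂ b * (f₁ a' * f₂ b') = f₁ (a * a') * f₂ (b * b') := by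
      rw [mul_assoc, ← mul_assoc (f₂ b), ← (hcomm a' b).eq, map_mul, map_mul]
      simp only [mul_assoc]
    rw [h1]
    rcases hB₁.2.2.1 a ha a' ha' with h | h
    · left; rw [h]; simp
    rcases hB₂.2.2.1 b hb b' hb' with h' | h'
    · left; rw [h']; simp
    · right; exact ⟨_, h, _, h', rfl⟩
  · exact LinearIndepOn.mono (v := id) hindC Set.inter_subset_left
  · apply le_antisymm
    · exact Submodule.span_le.2 fun x hx => hx.2
    intro x hx
    have hx' : x ∈ ringRad (MonoidAlgebra K (G₁ × G₂)) := hx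
    obtain ⟨c, hc⟩ : ∃ c : B₁ × B₂ → K, ∑ p, c p • F p = x := by
      rw [← Submodule.mem_span_range_iff_exists_fun, ← hCF, hspan]
      trivial
    obtain ⟨n, d, ρ, hρ, hρ'⟩ := fmb_pack (AlgebraicClosure K) hB₁
    obtain ⟨m, e, τ, hτ, hτ'⟩ := fmb_pack (AlgebraicClosure K) hB₂
    have hE : ∀ i j s t u v, ∑ b₁ : B₁, ∑ b₂ : B₂, algebraMap K (AlgebraicClosure K) (c (b₁, b₂)) *
        (ρ i b₁ s t * τ j b₂ u v) = 0 := by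
      intro i j s t u v
      obtain ⟨Φ, h1, h2⟩ := fmb_kron (ρ i) (τ j) (hρ i) (hτ j)
      have h3 := h2 x hx'
      rw [← hc, map_sum] at h3
      have h4 := congrFun (congrFun h3 (s, u)) (t, v)
      rw [Matrix.sum_apply, Fintype.sum_prod_type] at h4
      simp only [map_smul, hF, hf₁, hf₂, h1, Matrix.smul_apply, Matrix.kroneckerMap_apply,
        Matrix.zero_apply] at h4
      simp only [Algebra.smul_def] at h4
      exact h4
    have hc0 : ∀ (b₁ : B₁) (b₂ : B₂), (b₁ : MonoidAlgebra K G₁) ∉ ringRad (MonoidAlgebra K G₁) →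
        (b₂ : MonoidAlgebra K G₂) ∉ ringRad (MonoidAlgebra K G₂) → c (b₁, b₂) = 0 := by
      intro b₁ b₂ hb₁ hb₂
      have h1 := hτ' (fun b => algebraMap K (AlgebraicClosure K) (c (b₁, b))) ?_ b₂ hb₂
      · simpa using h1
      intro j
      ext u v
      have h2 := hρ' (fun a => ∑ b : B₂,
        algebraMap K (AlgebraicClosure K) (c (a, b)) * τ j b u v) ?_ b₁ hb₁
      · rw [Matrix.sum_apply]; exact h2
      intro i
      ext s t
      rw [Matrix.sum_apply, Matrix.zero_apply, ← hE i j s t u v]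
      refine Finset.sum_congr rfl fun a _ => ?_
      rw [Matrix.smul_apply, smul_eq_mul, Finset.sum_mul]
      exact Finset.sum_congr rfl fun b _ => by ring
    rw [← hc]
    refine Submodule.sum_mem _ fun p _ => ?_
    by_cases h1 : (p.1 : MonoidAlgebra K G₁) ∈ ringRad (MonoidAlgebra K G₁)
    · exact Submodule.smul_mem _ _ (Submodule.subset_span
        ⟨hCF ▸ ⟨p, rfl⟩, fmb_mul_mem_rad (hr₁ _ h1) _⟩)
    by_cases h2 : (p.2 : MonoidAlgebra K G₂) ∈ ringRad (MonoidAlgebra K G₂)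
    · exact Submodule.smul_mem _ _ (Submodule.subset_span
        ⟨hCF ▸ ⟨p, rfl⟩, Ideal.mul_mem_left _ _ (hr₂ _ h2)⟩)
    rw [hc0 p.1 p.2 h1 h2, zero_smul]
    exact zero_mem _
end

section
/- Let K be any field of characteristic 2 and let G = ⟨a, b | a^{2^n} = 1, b² = 1, b a b⁻¹ = a⁻¹⟩ with n ≥ 2 be the dihedral group of order 2^{n+1}. Set u = a + b and v = 1 + b in KG. Then the set {1, v, u^i, v u^i, u^j v, v u^j v : 1 ≤ i ≤ 2^{n-1}, 1 ≤ j ≤ 2^{n-1} - 1} is a filtered multiplicative K-basis of KG. -/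
section Abstract
variable {A : Type*} [Ring A]

/-- All words of the form `u^k`, `v u^k`, `u^k v`, `v u^k v`. -/
def wordSet (u v : A) : Set A :=
  {x | ∃ k : ℕ, x = u ^ k ∨ x = v * u ^ k ∨ x = u ^ k * v ∨ x = v * u ^ k * v}

lemma word_v_mul {u v : A} (m : ℕ) (hv : v * v = 0) (hm : u ^ (m + 1) = 0) {x : A}
    (hx : x ∈ wordSet u v) : v * x ∈ wordSet u v := by
  obtain ⟨k, rfl | rfl | rfl | rfl⟩ := hx
  · exact ⟨k, by simp⟩
  · exact ⟨m + 1, Or.inl (by rw [← mul_assoc, hv, hm, zero_mul])⟩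
  · exact ⟨k, by simp [mul_assoc]⟩
  · exact ⟨m + 1, Or.inl (by rw [← mul_assoc, ← mul_assoc, hv, hm, zero_mul, zero_mul])⟩

lemma uv_pow {u v : A} (huvu : u * v * u = u * u) (k : ℕ) :
    u * v * u ^ (k + 1) = u ^ (k + 2) := by
  rw [pow_succ', ← mul_assoc, huvu, pow_succ' u (k + 1), pow_succ' u k, mul_assoc]

lemma word_u_mul {u v : A} (huvu : u * v * u = u * u) {x : A}
    (hv : v * v = 0) (m : ℕ) (hm : u ^ (m + 1) = 0)
    (hx : x ∈ wordSet u v) : u * x ∈ wordSet u v := by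
  obtain ⟨k, rfl | rfl | rfl | rfl⟩ := hx
  · exact ⟨k + 1, Or.inl (pow_succ' u k).symm⟩
  · rcases k with _ | k
    · exact ⟨1, by simp⟩
    · exact ⟨k + 2, Or.inl (by rw [← mul_assoc, uv_pow huvu])⟩
  · exact ⟨k + 1, Or.inr (Or.inr (Or.inl (by rw [pow_succ', mul_assoc])))⟩
  · rcases k with _ | k
    · exact ⟨m + 1, Or.inl (by simp [hv, hm])⟩
    · exact ⟨k + 2, Or.inr (Or.inr (Or.inl (by rw [← mul_assoc, ← mul_assoc, uv_pow huvu])))⟩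

lemma word_upow_mul {u v : A} (huvu : u * v * u = u * u) {x : A}
    (hv : v * v = 0) (m : ℕ) (hm : u ^ (m + 1) = 0)
    (hx : x ∈ wordSet u v) (k : ℕ) : u ^ k * x ∈ wordSet u v := by
  induction k with
  | zero => simpa using hx
  | succ k ih => rw [pow_succ', mul_assoc]; exact word_u_mul huvu hv m hm ih

lemma word_mul {u v : A} (huvu : u * v * u = u * u) {x y : A}
    (hv : v * v = 0) (m : ℕ) (hm : u ^ (m + 1) = 0)
    (hy : y ∈ wordSet u v) (hx : x ∈ wordSet u v) : y * x ∈ wordSet u v := by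
  obtain ⟨k, rfl | rfl | rfl | rfl⟩ := hy
  · exact word_upow_mul huvu hv m hm hx k
  · rw [mul_assoc]
    exact word_v_mul m hv hm (word_upow_mul huvu hv m hm hx k)
  · rw [mul_assoc]
    exact word_upow_mul huvu hv m hm (word_v_mul m hv hm hx) k
  · rw [mul_assoc, mul_assoc]
    exact word_v_mul m hv hm (word_upow_mul huvu hv m hm (word_v_mul m hv hm hx) k)

/-- The candidate basis. -/
def basisSet (u v : A) (m : ℕ) : Set A :=
  {x | x = 1 ∨ x = v ∨
        (∃ i : ℕ, 1 ≤ i ∧ i ≤ m ∧ (x = u ^ i ∨ x = v * u ^ i)) ∨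
        (∃ j : ℕ, 1 ≤ j ∧ j ≤ m - 1 ∧ (x = u ^ j * v ∨ x = v * u ^ j * v))}

lemma basisSet_sub (u v : A) (m : ℕ) : basisSet u v m ⊆ wordSet u v := by
  rintro x (rfl | rfl | ⟨i, -, -, rfl | rfl⟩ | ⟨i, -, -, rfl | rfl⟩)
  · exact ⟨0, by simp⟩
  · exact ⟨0, by simp⟩
  · exact ⟨i, by simp⟩
  · exact ⟨i, by simp⟩
  · exact ⟨i, by simp⟩
  · exact ⟨i, by simp⟩

lemma wordSet_sub {u v : A} {m : ℕ} (h1 : 1 ≤ m) (hv : v * v = 0) (hm : u ^ (m + 1) = 0)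
    (hc : u ^ m * v = v * u ^ m) {x : A} (hx : x ∈ wordSet u v) :
    x = 0 ∨ x ∈ basisSet u v m := by
  obtain ⟨k, hx⟩ := hx
  rcases Nat.eq_zero_or_pos k with rfl | hk
  · simp only [pow_zero, mul_one, one_mul, hv] at hx
    rcases hx with h | h | h | h
    · exact Or.inr (Or.inl h)
    · exact Or.inr (Or.inr (Or.inl h))
    · exact Or.inr (Or.inr (Or.inl h))
    · exact Or.inl h
  rcases Nat.lt_or_ge m k with hmk | hmk
  · have : u ^ k = 0 := pow_eq_zero_of_le hmk hm
    left
    simpa [this] using hx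
  rcases hx with h | h | h | h
  · exact Or.inr (Or.inr (Or.inr (Or.inl ⟨k, hk, hmk, Or.inl h⟩)))
  · exact Or.inr (Or.inr (Or.inr (Or.inl ⟨k, hk, hmk, Or.inr h⟩)))
  · rcases Nat.eq_or_lt_of_le hmk with rfl | hlt
    · exact Or.inr (Or.inr (Or.inr (Or.inl ⟨k, hk, hmk, Or.inr (h.trans hc)⟩)))
    · exact Or.inr (Or.inr (Or.inr (Or.inr ⟨k, hk, by omega, Or.inl h⟩)))
  · rcases Nat.eq_or_lt_of_le hmk with rfl | hlt
    · left
      rw [h, mul_assoc, hc, ← mul_assoc, hv, zero_mul]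
    · exact Or.inr (Or.inr (Or.inr (Or.inr ⟨k, hk, by omega, Or.inr h⟩)))

/-- The finset version used for counting. -/
lemma basisSet_card (u v : A) {m : ℕ} (h1 : 1 ≤ m) :
    (basisSet u v m).Finite ∧ (basisSet u v m).ncard ≤ 4 * m := by
  classical
  let F : Finset A := (((({1, v} : Finset A) ∪ (Finset.Icc 1 m).image (fun i => u ^ i)) ∪
    (Finset.Icc 1 m).image (fun i => v * u ^ i)) ∪
    (Finset.Icc 1 (m - 1)).image (fun i => u ^ i * v)) ∪
    (Finset.Icc 1 (m - 1)).image (fun i => v * u ^ i * v)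
  have hF : basisSet u v m ⊆ (F : Set A) := by
    rintro x (rfl | rfl | ⟨i, h, h', rfl | rfl⟩ | ⟨i, h, h', rfl | rfl⟩) <;>
      simp only [F, Finset.coe_union, Set.mem_union, Finset.mem_coe, Finset.mem_image,
        Finset.mem_Icc, Finset.mem_insert, Finset.mem_singleton]
    · simp
    · simp
    · exact Or.inl (Or.inl (Or.inl (Or.inr ⟨i, ⟨h, h'⟩, rfl⟩)))
    · exact Or.inl (Or.inl (Or.inr ⟨i, ⟨h, h'⟩, rfl⟩))
    · exact Or.inl (Or.inr ⟨i, ⟨h, h'⟩, rfl⟩)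
    · exact Or.inr ⟨i, ⟨h, h'⟩, rfl⟩
  refine ⟨F.finite_toSet.subset hF, (Set.ncard_le_ncard hF F.finite_toSet).trans ?_⟩
  rw [Set.ncard_coe_finset]
  have e1 : ({1, v} : Finset A).card ≤ 2 := Finset.card_le_two
  have e2 := Finset.card_image_le (s := Finset.Icc 1 m) (f := fun i => u ^ i)
  have e3 := Finset.card_image_le (s := Finset.Icc 1 m) (f := fun i => v * u ^ i)
  have e4 := Finset.card_image_le (s := Finset.Icc 1 (m - 1)) (f := fun i => u ^ i * v)
  have e5 := Finset.card_image_le (s := Finset.Icc 1 (m - 1)) (f := fun i => v * u ^ i * v)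
  simp only [Nat.card_Icc] at e2 e3 e4 e5
  refine (Finset.card_union_le _ _).trans ?_
  refine (Nat.add_le_add_right (Finset.card_union_le _ _) _).trans ?_
  refine (Nat.add_le_add_right (Nat.add_le_add_right (Finset.card_union_le _ _) _) _).trans ?_
  refine (Nat.add_le_add_right (Nat.add_le_add_right (Nat.add_le_add_right
    (Finset.card_union_le _ _) _) _) _).trans ?_
  omega

/-- Right ideal generated by two elements, as a predicate. -/
def twoGen (p q : A) : Set A := {x | ∃ s t, x = p * s + q * t}

variable {K : Type*} [Field K] [Algebra K A]

lemma twoGen_left {u v p q : A} (hgen : Algebra.adjoin K {u, v} = ⊤)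
    (hup : u * p ∈ twoGen p q) (huq : u * q ∈ twoGen p q)
    (hvp : v * p ∈ twoGen p q) (hvq : v * q ∈ twoGen p q) (y : A) :
    ∀ x ∈ twoGen p q, y * x ∈ twoGen p q := by
  have key : ∀ g : A, g * p ∈ twoGen p q → g * q ∈ twoGen p q →
      ∀ x ∈ twoGen p q, g * x ∈ twoGen p q := by
    rintro g ⟨s, t, h1⟩ ⟨s', t', h2⟩ x ⟨c, d, rfl⟩
    refine ⟨s * c + s' * d, t * c + t' * d, ?_⟩
    rw [mul_add, ← mul_assoc, ← mul_assoc, h1, h2]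
    noncomm_ring
  have hy : y ∈ Algebra.adjoin K {u, v} := by rw [hgen]; trivial
  induction hy using Algebra.adjoin_induction with
  | mem g hg =>
    rcases hg with rfl | rfl
    · exact key _ hup huq
    · exact key _ hvp hvq
  | algebraMap r =>
    rintro x ⟨c, d, rfl⟩
    refine ⟨algebraMap K A r * c, algebraMap K A r * d, ?_⟩
    rw [mul_add, Algebra.left_comm, Algebra.left_comm]
  | add y z _ _ h1 h2 =>
    intro x hx
    obtain ⟨s, t, e⟩ := h1 x hx
    obtain ⟨s', t', e'⟩ := h2 x hx
    exact ⟨s + s', t + t', by rw [add_mul, e, e']; noncomm_ring⟩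
  | mul y z _ _ h1 h2 =>
    intro x hx
    rw [mul_assoc]
    exact h1 _ (h2 _ hx)

lemma leftM {u v : A} (hgen : Algebra.adjoin K {u, v} = ⊤)
    (huvu : u * v * u = u * u) (hv : v * v = 0) (k : ℕ) (y : A) :
    ∀ x ∈ twoGen (v * u ^ k) (u ^ (k + 1)), y * x ∈ twoGen (v * u ^ k) (u ^ (k + 1)) := by
  apply twoGen_left hgen
  · rcases k with _ | k
    · exact ⟨0, v, by simp⟩
    · exact ⟨0, 1, by rw [← mul_assoc, uv_pow huvu]; simp⟩
  · exact ⟨0, u, by rw [← pow_succ', ← pow_succ]; simp⟩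
  · exact ⟨0, 0, by rw [← mul_assoc, hv]; simp⟩
  · exact ⟨u, 0, by rw [pow_succ]; simp [mul_assoc]⟩

lemma leftN {u v : A} (hgen : Algebra.adjoin K {u, v} = ⊤)
    (huvu : u * v * u = u * u) (hv : v * v = 0) (k : ℕ) (y : A) :
    ∀ x ∈ twoGen (u ^ (k + 1)) (v * u ^ (k + 1)),
      y * x ∈ twoGen (u ^ (k + 1)) (v * u ^ (k + 1)) := by
  apply twoGen_left hgen
  · exact ⟨u, 0, by rw [← pow_succ', ← pow_succ]; simp⟩
  · exact ⟨u, 0, by rw [← mul_assoc, uv_pow huvu, ← pow_succ]; simp⟩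
  · exact ⟨0, 1, by simp⟩
  · exact ⟨0, 0, by rw [← mul_assoc, hv]; simp⟩

lemma stepM {u v : A} (hgen : Algebra.adjoin K {u, v} = ⊤)
    (huvu : u * v * u = u * u) (hv : v * v = 0) (k : ℕ) {x z : A}
    (hx : x ∈ twoGen v u) (hz : z ∈ twoGen (v * u ^ k) (u ^ (k + 1))) :
    x * z ∈ twoGen (u ^ (k + 1)) (v * u ^ (k + 1)) := by
  obtain ⟨s, t, rfl⟩ := hx
  obtain ⟨c, d, h1⟩ := leftM hgen huvu hv k s z hz
  obtain ⟨c', d', h2⟩ := leftM hgen huvu hv k t z hz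
  have e : v * (v * u ^ k * c) = 0 := by simp only [← mul_assoc, hv, zero_mul]
  rcases k with _ | k
  · refine ⟨v * c' + u * d', d, ?_⟩
    rw [add_mul, mul_assoc, mul_assoc, h1, h2, mul_add, e]
    noncomm_ring
  · refine ⟨c' + u * d', d, ?_⟩
    rw [add_mul, mul_assoc, mul_assoc, h1, h2, mul_add, e, mul_add]
    have e2 : u * (v * u ^ (k + 1) * c') = u ^ (k + 1 + 1) * c' := by
      rw [← mul_assoc, ← mul_assoc, uv_pow huvu]
    have e3 : u * (u ^ (k + 1 + 1) * d') = u ^ (k + 1 + 1) * (u * d') := by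
      rw [← mul_assoc, ← mul_assoc, ← pow_succ', ← pow_succ]
    rw [e2, e3, zero_add, mul_add, mul_assoc v, add_comm]

lemma stepN {u v : A} (hgen : Algebra.adjoin K {u, v} = ⊤)
    (huvu : u * v * u = u * u) (hv : v * v = 0) (k : ℕ) {x z : A}
    (hx : x ∈ twoGen v u) (hz : z ∈ twoGen (u ^ (k + 1)) (v * u ^ (k + 1))) :
    x * z ∈ twoGen (v * u ^ (k + 1)) (u ^ (k + 1 + 1)) := by
  obtain ⟨s, t, rfl⟩ := hx
  obtain ⟨c, d, h1⟩ := leftN hgen huvu hv k s z hz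
  obtain ⟨c', d', h2⟩ := leftN hgen huvu hv k t z hz
  have e : v * (v * u ^ (k + 1) * d) = 0 := by simp only [← mul_assoc, hv, zero_mul]
  refine ⟨c, c' + d', ?_⟩
  have e2 : u * (v * u ^ (k + 1) * d') = u ^ (k + 1 + 1) * d' := by
    rw [← mul_assoc, ← mul_assoc, uv_pow huvu]
  rw [add_mul, mul_assoc, mul_assoc, h1, h2, mul_add, e, mul_add, e2, add_zero, mul_add,
    ← mul_assoc u, ← pow_succ', mul_assoc v]

lemma nilp {u v : A} (hgen : Algebra.adjoin K {u, v} = ⊤)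
    (huvu : u * v * u = u * u) (hv : v * v = 0) (m : ℕ) (hm : u ^ (m + 1) = 0) {x : A}
    (hx : x ∈ twoGen v u) : IsNilpotent x := by
  have h : ∀ k, x ^ (2 * k + 1) ∈ twoGen (v * u ^ k) (u ^ (k + 1)) := by
    intro k
    induction k with
    | zero => simpa using hx
    | succ k ih =>
      have := stepN hgen huvu hv k hx (stepM hgen huvu hv k hx ih)
      rwa [← pow_succ', ← pow_succ'] at this
  obtain ⟨s, t, e⟩ := h (m + 1)
  exact ⟨_, by rw [e, hm, pow_succ, hm]; simp⟩

lemma mem_rad {u v : A} (hgen : Algebra.adjoin K {u, v} = ⊤)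
    (huvu : u * v * u = u * u) (hv : v * v = 0) (m : ℕ) (hm : u ^ (m + 1) = 0) {x : A}
    (hx : x ∈ twoGen v u) : x ∈ ringRad A := by
  unfold ringRad
  rw [Ideal.mem_jacobson_iff]
  intro y
  have h0 := leftM hgen huvu hv 0 y
  simp only [pow_zero, mul_one, zero_add, pow_one] at h0
  have hn := nilp hgen huvu hv m hm (h0 x hx)
  obtain ⟨w, hw⟩ := hn.isUnit_one_add
  refine ⟨(w⁻¹ : Aˣ), ?_⟩
  have : ((w⁻¹ : Aˣ) : A) * (1 + y * x) = 1 := by rw [← hw]; simp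
  rw [mul_add, mul_one, ← mul_assoc] at this
  rw [Ideal.mem_bot, add_comm, this, sub_self]

lemma basisSet_mem {u v : A} (m : ℕ) {x : A} (hx : x ∈ basisSet u v m) :
    x = 1 ∨ x ∈ twoGen v u := by
  rcases hx with rfl | rfl | ⟨i, h, -, rfl | rfl⟩ | ⟨i, h, -, rfl | rfl⟩
  · exact Or.inl rfl
  · exact Or.inr ⟨1, 0, by simp⟩
  · obtain ⟨i, rfl⟩ := Nat.exists_eq_add_of_le' h
    exact Or.inr ⟨0, u ^ i, by simp [pow_succ']⟩
  · exact Or.inr ⟨u ^ i, 0, by simp⟩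
  · obtain ⟨i, rfl⟩ := Nat.exists_eq_add_of_le' h
    exact Or.inr ⟨0, u ^ i * v, by simp [pow_succ', mul_assoc]⟩
  · exact Or.inr ⟨u ^ i * v, 0, by simp [mul_assoc]⟩

theorem abstract_main [Nontrivial A] {u v : A} (hgen : Algebra.adjoin K {u, v} = ⊤)
    (huvu : u * v * u = u * u) (hv : v * v = 0) (m : ℕ) (h1 : 1 ≤ m) (hm : u ^ (m + 1) = 0)
    (hc : u ^ m * v = v * u ^ m) (hdim : Module.finrank K A = 4 * m) :
    IsFilteredMulBasis K (basisSet u v m) := by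
  have hmul : ∀ b₁ ∈ basisSet u v m, ∀ b₂ ∈ basisSet u v m,
      b₁ * b₂ = 0 ∨ b₁ * b₂ ∈ basisSet u v m := fun x hx y hy =>
    wordSet_sub h1 hv hm hc
      (word_mul huvu hv m hm (basisSet_sub _ _ _ hx) (basisSet_sub _ _ _ hy))
  have hspan : Submodule.span K (basisSet u v m) = ⊤ := by
    rw [eq_top_iff]
    have hle : Submodule.span K (basisSet u v m) * Submodule.span K (basisSet u v m) ≤
        Submodule.span K (basisSet u v m) := by
      rw [Submodule.span_mul_span, Submodule.span_le]
      rintro _ ⟨x, hx, y, hy, rfl⟩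
      rcases hmul x hx y hy with h | h
      · simp only [h]; exact Submodule.zero_mem _
      · exact Submodule.subset_span h
    have hone : (1 : A) ∈ Submodule.span K (basisSet u v m) :=
      Submodule.subset_span (Or.inl rfl)
    intro y _
    have hy : y ∈ Algebra.adjoin K {u, v} := by rw [hgen]; trivial
    induction hy using Algebra.adjoin_induction with
    | mem g hg =>
      rcases hg with rfl | rfl
      · exact Submodule.subset_span (Or.inr (Or.inr (Or.inl ⟨1, le_rfl, h1, by simp⟩)))
      · exact Submodule.subset_span (Or.inr (Or.inl rfl))
    | algebraMap r =>
      rw [Algebra.algebraMap_eq_smul_one]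
      exact Submodule.smul_mem _ _ hone
    | add y z _ _ h1 h2 => exact Submodule.add_mem _ (h1 trivial) (h2 trivial)
    | mul y z _ _ h1 h2 => exact hle (Submodule.mul_mem_mul (h1 trivial) (h2 trivial))
  obtain ⟨hfin, hcard⟩ := basisSet_card u v h1
  have hli : LinearIndependent K ((↑) : basisSet u v m → A) := by
    have := hfin.fintype
    have hr : Set.range ((↑) : basisSet u v m → A) = basisSet u v m := Subtype.range_coe
    apply linearIndependent_of_top_le_span_of_card_eq_finrank
    · rw [hr, hspan]
    · apply le_antisymm
      · rw [hdim, ← Nat.card_eq_fintype_card]; exact hcard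
      · have := finrank_range_le_card (R := K) ((↑) : basisSet u v m → A)
        rw [Set.finrank, hr, hspan, finrank_top] at this
        exact this
  have hone : (1 : A) ∉ ringRad A := by
    intro h
    have := (Ideal.eq_top_iff_one _).2 h
    rw [ringRad, Ideal.jacobson_eq_top_iff] at this
    exact bot_ne_top this
  refine ⟨hli, hspan, hmul, LinearIndepOn.mono (show LinearIndepOn K id (basisSet u v m) from hli) Set.inter_subset_left, ?_⟩
  have hle : Submodule.span K (basisSet u v m ∩ (ringRad A : Set A)) ≤
      Submodule.restrictScalars K (ringRad A) := by
    rw [Submodule.span_le]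
    exact Set.inter_subset_right
  refine le_antisymm hle ?_
  intro y hy
  have hins : basisSet u v m ⊆ insert 1 (basisSet u v m ∩ (ringRad A : Set A)) := by
    intro x hx
    rcases basisSet_mem m hx with h | h
    · exact Or.inl h
    · exact Or.inr ⟨hx, mem_rad hgen huvu hv m hm h⟩
  have hy' : y ∈ Submodule.span K (insert 1 (basisSet u v m ∩ (ringRad A : Set A))) :=
    Submodule.span_mono hins (by rw [hspan]; trivial)
  obtain ⟨c, z, hz, e⟩ := Submodule.mem_span_insert.1 hy'
  have hc1 : c • (1 : A) ∈ Submodule.restrictScalars K (ringRad A) := by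
    have : c • (1 : A) = y - z := by rw [e]; simp
    rw [this]
    exact Submodule.sub_mem _ hy (hle hz)
  have hc0 : c = 0 := by
    by_contra h
    apply hone
    have := Submodule.smul_mem _ c⁻¹ hc1
    rwa [smul_smul, inv_mul_cancel₀ h, one_smul] at this
  rw [e, hc0, zero_smul, zero_add]
  exact hz

end Abstract

theorem stmt_7 {K : Type*} [Field K] [CharP K 2]
    {G : Type*} [Group G] (n : ℕ) (hn : 2 ≤ n) (a b : G)
    (ha : a ^ 2 ^ n = 1) (hb : b ^ 2 = 1) (hconj : b * a * b⁻¹ = a⁻¹)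
    (hgen : Subgroup.closure {a, b} = (⊤ : Subgroup G))
    (hcard : Nat.card G = 2 ^ (n + 1)) :
    IsFilteredMulBasis K
      {x : MonoidAlgebra K G |
        x = 1 ∨ x = 1 + MonoidAlgebra.of K G b ∨
        (∃ i : ℕ, 1 ≤ i ∧ i ≤ 2 ^ (n - 1) ∧
          (x = (MonoidAlgebra.of K G a + MonoidAlgebra.of K G b) ^ i ∨
           x = (1 + MonoidAlgebra.of K G b) *
               (MonoidAlgebra.of K G a + MonoidAlgebra.of K G b) ^ i)) ∨
        (∃ j : ℕ, 1 ≤ j ∧ j ≤ 2 ^ (n - 1) - 1 ∧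
          (x = (MonoidAlgebra.of K G a + MonoidAlgebra.of K G b) ^ j *
               (1 + MonoidAlgebra.of K G b) ∨
           x = (1 + MonoidAlgebra.of K G b) *
               (MonoidAlgebra.of K G a + MonoidAlgebra.of K G b) ^ j *
               (1 + MonoidAlgebra.of K G b)))} := by
  have h2m : 2 * 2 ^ (n - 1) = 2 ^ n := by
    rw [← pow_succ']; congr 1; omega
  have hfinG : Finite G := Nat.finite_of_card_ne_zero (by rw [hcard]; positivity)
  have := Fintype.ofFinite G
  set a' : MonoidAlgebra K G := MonoidAlgebra.of K G a with ha'
  set b' : MonoidAlgebra K G := MonoidAlgebra.of K G b with hb'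
  set i' : MonoidAlgebra K G := MonoidAlgebra.of K G a⁻¹ with hi'
  have : CharP (MonoidAlgebra K G) 2 :=
    charP_of_injective_algebraMap (algebraMap K (MonoidAlgebra K G)).injective 2
  have two : (2 : MonoidAlgebra K G) = 0 := CharTwo.two_eq_zero
  have hbb : b' * b' = 1 := by rw [hb', ← map_mul, ← pow_two, hb, map_one]
  have hai : a' * i' = 1 := by rw [ha', hi', ← map_mul, mul_inv_cancel, map_one]
  have hia : i' * a' = 1 := by rw [ha', hi', ← map_mul, inv_mul_cancel, map_one]
  have hba : b' * a' = i' * b' := by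
    rw [ha', hb', hi', ← map_mul, ← map_mul, ← hconj, inv_mul_cancel_right]
  have hbi : b' * i' = a' * b' := by
    calc b' * i' = (a' * i') * b' * i' := by rw [hai, one_mul]
      _ = a' * (b' * a') * i' := by rw [hba]; simp only [mul_assoc]
      _ = a' * b' := by rw [mul_assoc, mul_assoc, hai, mul_one]
  have hv : (1 + b') * (1 + b') = 0 := by
    calc (1 + b') * (1 + b') = 1 + 2 * b' + b' * b' := by noncomm_ring
      _ = 2 := by rw [hbb, two, zero_mul, add_zero]; exact one_add_one_eq_two.trans two
      _ = 0 := two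
  have hub : (a' + b') * b' * (a' + b') = 0 := by
    calc (a' + b') * b' * (a' + b')
        = a' * (b' * a') + a' * (b' * b') + b' * b' * a' + b' * b' * b' := by noncomm_ring
      _ = (a' * i') * b' + a' + a' + b' := by rw [hba, hbb]; noncomm_ring
      _ = 2 * (a' + b') := by rw [hai]; noncomm_ring
      _ = 0 := by rw [two, zero_mul]
  have huvu : (a' + b') * (1 + b') * (a' + b') = (a' + b') * (a' + b') := by
    rw [mul_add (a' + b') 1 b', mul_one, add_mul _ _ (a' + b'), hub, add_zero]
  set z := a' + i' with hz
  have hza : Commute z a' := by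
    show (a' + i') * a' = a' * (a' + i')
    rw [add_mul, mul_add, hai, hia]
  have hzb : Commute z b' := by
    show (a' + i') * b' = b' * (a' + i')
    rw [add_mul, mul_add, hba, hbi, add_comm]
  have hzu : Commute z (a' + b') := hza.add_right hzb
  have huu : (a' + b') * (a' + b') = z * (a' + b') := by
    rw [hz, add_mul, add_mul, mul_add, mul_add, mul_add, hbb, hba, hia]
    abel
  have hpow : ∀ k : ℕ, (a' + b') ^ (k + 1) = z ^ k * (a' + b') := by
    intro k
    induction k with
    | zero => simp
    | succ k ih => rw [pow_succ, ih, mul_assoc, huu, ← mul_assoc, ← pow_succ]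
  have hzm : z ^ 2 ^ (n - 1) = 0 := by
    rw [hz, add_pow_char_pow_of_commute _ _ (show Commute a' i' from hai.trans hia.symm)]
    have : i' ^ 2 ^ (n - 1) = a' ^ 2 ^ (n - 1) := by
      rw [ha', hi', ← map_pow, ← map_pow]
      congr 1
      rw [inv_pow, inv_eq_iff_mul_eq_one, ← pow_add, ← two_mul, h2m, ha]
    rw [this, ← two_mul, two, zero_mul]
  have h1m : 1 ≤ 2 ^ (n - 1) := Nat.one_le_two_pow
  have hm : (a' + b') ^ (2 ^ (n - 1) + 1) = 0 := by rw [hpow, hzm, zero_mul]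
  have hc : (a' + b') ^ 2 ^ (n - 1) * (1 + b') = (1 + b') * (a' + b') ^ 2 ^ (n - 1) := by
    obtain ⟨k, hk⟩ := Nat.exists_eq_add_of_le' h1m
    rw [hk] at hzm ⊢
    rw [mul_add, add_mul, mul_one, one_mul, hpow]
    congr 1
    rw [← mul_assoc, ← (hzb.pow_left k).eq, mul_assoc, mul_assoc]
    have e : (a' + b') * b' = z * b' + b' * (a' + b') := by
      have : z * b' + b' * (a' + b') = (a' + b') * b' + 2 * (i' * b') := by
        rw [hz, add_mul, mul_add, add_mul, hba]
        noncomm_ring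
      rw [this, two, zero_mul, add_zero]
    rw [e, mul_add, ← mul_assoc, ← pow_succ, hzm, zero_mul, zero_add]
  have hdim : Module.finrank K (MonoidAlgebra K G) = 4 * 2 ^ (n - 1) := by
    have h : Module.finrank K (MonoidAlgebra K G) = Nat.card G := by
      rw [Nat.card_eq_fintype_card]
      exact Module.finrank_eq_card_basis (MonoidAlgebra.basis G K)
    rw [h, hcard, pow_succ, ← h2m]
    ring
  have hgen' : Algebra.adjoin K {a' + b', 1 + b'} = ⊤ := by
    set S := Algebra.adjoin K {a' + b', 1 + b'} with hS
    have hu : a' + b' ∈ S := Algebra.subset_adjoin (by simp)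
    have hv' : 1 + b' ∈ S := Algebra.subset_adjoin (by simp)
    have hbS : b' ∈ S := by
      have := S.sub_mem hv' S.one_mem
      rwa [add_sub_cancel_left] at this
    have haS : a' ∈ S := by
      have := S.sub_mem hu hbS
      rwa [add_sub_cancel_right] at this
    have hg : ∀ g : G, MonoidAlgebra.of K G g ∈ S := by
      intro g
      have hgg : g ∈ Subgroup.closure {a, b} := by rw [hgen]; trivial
      induction hgg using Subgroup.closure_induction with
      | mem x hx =>
        rcases hx with rfl | rfl
        · exact haS
        · exact hbS
      | one => rw [map_one]; exact S.one_mem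
      | mul x y _ _ h1 h2 => rw [map_mul]; exact S.mul_mem h1 h2
      | inv x _ h =>
        have : x⁻¹ = x ^ (Nat.card G - 1) := by
          rw [inv_eq_iff_mul_eq_one, ← pow_succ', Nat.sub_add_cancel Nat.card_pos,
            pow_card_eq_one']
        rw [this, map_pow]
        exact S.pow_mem h _
    rw [eq_top_iff]
    intro x _
    induction x using MonoidAlgebra.induction_on with
    | of g => exact hg g
    | add x y h1 h2 => exact S.add_mem (h1 trivial) (h2 trivial)
    | smul r x h => exact S.smul_mem (h trivial) r
  exact abstract_main hgen' huvu hv (2 ^ (n - 1)) h1m hm hc hdim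
end

section
/- Let K be a field of characteristic 2 and let G = ⟨a, b | a^{2^n} = 1, b² = a^{2^{n-1}}, b a b⁻¹ = a⁻¹⟩ with n ≥ 3 be the generalized quaternion group of order 2^{n+1}. Then the group algebra KG has no filtered multiplicative K-basis. -/
/-- Abstract model of the quaternion group algebra as `R ⊕ R b`. -/
structure QM (K A R : Type*) [Field K] [Ring A] [Algebra K A] [CommRing R] [Algebra K R]
    (N : ℕ) where
  two : (2 : R) = 0
  ep : R →ₐ[K] K
  sg : R →ₐ[K] R
  X : R
  a' : R
  c : R
  e : R
  mu : R →ₗ[K] K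
  Phi : (R × R) ≃ₗ[K] A
  ha' : (1 + X) * a' = 1
  sgX : sg X = a' * X
  loc : ∀ r, ∃ s, r = algebraMap K R (ep r) + X * s
  epX : ep X = 0
  epsg : ∀ r, ep (sg r) = ep r
  XN : X ^ N = 0
  XN1 : X ^ (N - 1) ≠ 0
  hc : c = 1 + X ^ 3 * e
  sgc : sg c = c
  sgsg : ∀ r, sg (sg r) = r
  musg : ∀ r, mu (sg r) = mu r
  H1 : ∀ f g, X ^ 2 * (f + sg f) = 0 → mu (f ^ 2 + c * (g * sg g)) = ep g ^ 2
  H2 : ∀ f, X * (f + sg f) = 0 → f + sg f = 0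
  mul : ∀ f g f' g', Phi (f, g) * Phi (f', g') =
    Phi (f * f' + c * (g * sg g'), f * g' + g * sg f')

namespace QM

variable {K A R : Type*} [Field K] [Ring A] [Algebra K A] [CommRing R] [Algebra K R]
  {N : ℕ} (Q : QM K A R N)

/-- `z` lies in the `(k+1)`-st power of the radical, with leading coefficients `α, β`. -/
def Lv (k : ℕ) (α β : K) (z : A) : Prop :=
  ∃ p h, Q.ep p = α ∧ Q.ep h = β ∧ z = Q.Phi (Q.X ^ k * p, Q.X ^ k * p + Q.X ^ (k + 1) * h)

/-- `z` lies in the `(k+1)`-st power of the radical. -/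
def M (k : ℕ) (z : A) : Prop :=
  ∃ p h, z = Q.Phi (Q.X ^ k * p, Q.X ^ k * p + Q.X ^ (k + 1) * h)

include Q in
theorem twoK : (2 : K) = 0 := by
  have := congrArg Q.ep Q.two
  rwa [map_ofNat, map_zero] at this

theorem Lv.M {Q : QM K A R N} {k α β z} (h : Q.Lv k α β z) : Q.M k z := by
  obtain ⟨p, h, -, -, e⟩ := h
  exact ⟨p, h, e⟩

theorem M.Lv {Q : QM K A R N} {k z} (h : Q.M k z) : ∃ α β, Q.Lv k α β z := by
  obtain ⟨p, h, e⟩ := h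
  exact ⟨_, _, p, h, rfl, rfl, e⟩

theorem Lv.add {Q : QM K A R N} {k α β α' β' z z'} (h : Q.Lv k α β z) (h' : Q.Lv k α' β' z') :
    Q.Lv k (α + α') (β + β') (z + z') := by
  obtain ⟨p, h, rfl, rfl, rfl⟩ := h
  obtain ⟨p', h', rfl, rfl, rfl⟩ := h'
  refine ⟨p + p', h + h', by simp, by simp, ?_⟩
  rw [← map_add]
  congr 1
  ext <;> simp <;> ring

theorem Lv.smul {Q : QM K A R N} {k α β z} (h : Q.Lv k α β z) (t : K) :
    Q.Lv k (t * α) (t * β) (t • z) := by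
  obtain ⟨p, h, rfl, rfl, rfl⟩ := h
  refine ⟨t • p, t • h, by simp, by simp, ?_⟩
  rw [← map_smul]
  congr 1
  ext <;> simp

theorem Lv.succ {Q : QM K A R N} {k z} (h : Q.Lv k 0 0 z) : Q.M (k + 1) z := by
  obtain ⟨p, h, hp, hh, rfl⟩ := h
  obtain ⟨s, hs⟩ := Q.loc p
  obtain ⟨s', hs'⟩ := Q.loc h
  rw [hp, map_zero, zero_add] at hs
  rw [hh, map_zero, zero_add] at hs'
  refine ⟨s, s', ?_⟩
  congr 1
  rw [hs, hs']
  ext <;> simp <;> ring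

theorem M.toLv {Q : QM K A R N} {k z} (h : Q.M (k + 1) z) : Q.Lv k 0 0 z := by
  obtain ⟨p, h, rfl⟩ := h
  refine ⟨Q.X * p, Q.X * h, by simp [Q.epX], by simp [Q.epX], ?_⟩
  congr 1
  ext <;> simp <;> ring

theorem M.mono {Q : QM K A R N} {j k z} (h : Q.M k z) (hjk : j ≤ k) : Q.M j z := by
  induction k, hjk using Nat.le_induction with
  | base => exact h
  | succ k _ ih => exact ih h.toLv.M

theorem M.zero {Q : QM K A R N} {k z} (h : Q.M k z) (hk : N ≤ k) : z = 0 := by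
  obtain ⟨p, h, rfl⟩ := h.mono hk
  rw [pow_succ, Q.XN]
  simp

theorem M_zero (k : ℕ) : Q.M k (0 : A) := ⟨0, 0, by rw [mul_zero, mul_zero, add_zero, ← Prod.zero_eq_mk, map_zero]⟩

theorem X_cancel {k : ℕ} (hk : k < N) {p : R} (h : Q.X ^ k * p = 0) : Q.ep p = 0 := by
  obtain ⟨s, hs⟩ := Q.loc p
  by_contra hne
  have h1 : Q.X ^ (N - 1) * p = 0 := by
    have : N - 1 = (N - 1 - k) + k := by omega
    rw [this, pow_add, mul_assoc, h, mul_zero]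
  have h2 : Q.X ^ (N - 1) * Q.X = 0 := by
    rw [← pow_succ, show N - 1 + 1 = N by omega, Q.XN]
  rw [hs, mul_add, ← mul_assoc, h2, zero_mul, add_zero, mul_comm, ← Algebra.smul_def] at h1
  rcases smul_eq_zero.1 h1 with h1 | h1
  · exact hne h1
  · exact Q.XN1 h1

theorem Lv.zero1 {Q : QM K A R N} {k α β} (h : Q.Lv k α β (0 : A)) (hk : k < N) : α = 0 := by
  obtain ⟨p, h, rfl, rfl, e⟩ := h
  have := (map_eq_zero_iff Q.Phi Q.Phi.injective).1 e.symm
  simp only [Prod.mk_eq_zero] at this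
  exact Q.X_cancel hk this.1

theorem Lv.zero2 {Q : QM K A R N} {k α β} (h : Q.Lv k α β (0 : A)) (hk : k + 1 < N) : β = 0 := by
  obtain ⟨p, h, rfl, rfl, e⟩ := h
  have := (map_eq_zero_iff Q.Phi Q.Phi.injective).1 e.symm
  simp only [Prod.mk_eq_zero] at this
  rw [this.1, zero_add] at this
  exact Q.X_cancel hk this.2

theorem Lv.uniq {Q : QM K A R N} {k α β α' β' z} (h : Q.Lv k α β z) (h' : Q.Lv k α' β' z)
    (hk : k + 1 < N) : α = α' ∧ β = β' := by
  have := h.add (h'.smul (-1))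
  simp only [neg_smul, one_smul, add_neg_cancel] at this
  have h1 := this.zero1 (by omega)
  have h2 := this.zero2 hk
  constructor
  · linear_combination h1
  · linear_combination h2

theorem Lv.uniq1 {Q : QM K A R N} {k α β α' β' z} (h : Q.Lv k α β z) (h' : Q.Lv k α' β' z)
    (hk : k < N) : α = α' := by
  have := h.add (h'.smul (-1))
  simp only [neg_smul, one_smul, add_neg_cancel] at this
  linear_combination this.zero1 hk

theorem sg_loc (r : R) : ∃ d, Q.sg r = r + Q.X * d ∧ Q.ep d = 0 := by
  obtain ⟨s, hs⟩ := Q.loc r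
  refine ⟨Q.a' * Q.sg s + s, ?_, ?_⟩
  · have : Q.sg r = algebraMap K R (Q.ep r) + Q.a' * Q.X * Q.sg s := by
      conv_lhs => rw [hs]
      simp [Q.sgX]
    rw [this]
    conv_rhs => rw [hs]
    linear_combination (-(Q.X * s)) * Q.two
  · have h1 : Q.ep Q.a' = 1 := by
      have := congrArg Q.ep Q.ha'
      simpa [Q.epX] using this
    simp only [map_add, map_mul, h1, Q.epsg]
    linear_combination Q.ep s * Q.twoK

theorem a'_eq : Q.a' = 1 + Q.X * Q.a' := by
  linear_combination Q.ha' - (Q.X * Q.a') * Q.two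

theorem ep_a' : Q.ep Q.a' = 1 := by
  have := congrArg Q.ep Q.ha'
  simpa [Q.epX] using this

theorem a'_pow (k : ℕ) : ∃ t, Q.a' ^ k = 1 + Q.X * t ∧ (k = 0 → t = 0) := by
  induction k with
  | zero => exact ⟨0, by simp, fun _ => rfl⟩
  | succ k ih =>
    obtain ⟨t, ht, -⟩ := ih
    refine ⟨t + Q.a' + Q.X * t * Q.a', ?_, by simp⟩
    rw [pow_succ, ht]
    linear_combination (1 + Q.X * t) * Q.a'_eq

theorem mul_aux (j k : ℕ) (p h p' h' : R) : ∃ q r,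
    Q.Phi (Q.X ^ j * p, Q.X ^ j * p + Q.X ^ (j + 1) * h) *
      Q.Phi (Q.X ^ k * p', Q.X ^ k * p' + Q.X ^ (k + 1) * h') =
      Q.Phi (Q.X ^ (j + k + 1) * q, Q.X ^ (j + k + 1) * q + Q.X ^ (j + k + 1 + 1) * r) ∧
    (k = 0 → Q.ep q = Q.ep h * Q.ep p' + Q.ep p * Q.ep h' ∧
      Q.ep r = (Q.ep p + Q.ep h) * Q.ep h') := by
  obtain ⟨d, hd, hd0⟩ := Q.sg_loc p'
  obtain ⟨d', hd', hd0'⟩ := Q.sg_loc h'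
  obtain ⟨t, ht, ht0⟩ := Q.a'_pow k
  have ha := Q.a'_eq
  have hc := Q.hc
  have h2 := Q.two
  obtain ⟨w, hw⟩ : ∃ w, w = d + Q.a' * Q.sg h' := ⟨_, rfl⟩
  obtain ⟨u1, hu1⟩ : ∃ u1, u1 = Q.X ^ 2 * Q.e * (1 + Q.X * t) + t := ⟨_, rfl⟩
  obtain ⟨v, hv⟩ : ∃ v, v = p * w + h * p' + Q.X * h * w := ⟨_, rfl⟩
  obtain ⟨u2, hu2⟩ : ∃ u2, u2 = u1 + Q.a' + Q.X * u1 * Q.a' := ⟨_, rfl⟩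
  obtain ⟨v2, hv2⟩ : ∃ v2, v2 = p * d' + h * h' + Q.X * h * d' := ⟨_, rfl⟩
  have hcu : Q.c * Q.a' ^ k = 1 + Q.X * u1 := by
    rw [hc, ht, hu1]; ring
  have hcu2 : Q.c * Q.a' ^ k * Q.a' = 1 + Q.X * u2 := by
    rw [hcu, hu2]; linear_combination (1 + Q.X * u1) * ha
  have sgg : Q.sg (Q.X ^ k * p' + Q.X ^ (k + 1) * h') =
      Q.a' ^ k * Q.X ^ k * (p' + Q.X * w) := by
    simp only [map_add, map_mul, map_pow, Q.sgX, hd, hw]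
    ring
  have sgp : Q.sg (Q.X ^ k * p') = Q.a' ^ k * Q.X ^ k * Q.sg p' := by
    simp only [map_mul, map_pow, Q.sgX]
    ring
  refine ⟨v + u1 * (p * p' + Q.X * v), v2 + u2 * (p * h' + Q.X * v2) +
    Q.X * Q.e * (1 + Q.X * t) * (p + Q.X * h) * Q.sg p', ?_, ?_⟩
  · rw [Q.mul]
    have e1 : Q.X ^ j * p * (Q.X ^ k * p') + Q.c * ((Q.X ^ j * p + Q.X ^ (j + 1) * h) *
        Q.sg (Q.X ^ k * p' + Q.X ^ (k + 1) * h')) =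
        Q.X ^ (j + k + 1) * (v + u1 * (p * p' + Q.X * v)) := by
      rw [sgg, hv]
      linear_combination (Q.X ^ (j + k) * (p + Q.X * h) * (p' + Q.X * w)) * hcu +
        (Q.X ^ (j + k) * p * p') * h2
    refine congrArg Q.Phi (Prod.ext e1 ?_)
    rw [← e1]
    simp only
    have e2 : Q.c * Q.sg (Q.X ^ k * p' + Q.X ^ (k + 1) * h') =
        Q.c * Q.a' ^ k * Q.X ^ k * Q.sg p' +
        Q.X ^ (k + 1) * (1 + Q.X * u2) * (h' + Q.X * d') := by
      rw [sgg, hw, ← hcu2, ← hd', hd]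
      ring
    have e3 : Q.c * Q.a' ^ k = Q.a' ^ k + Q.X ^ 3 * Q.e * (1 + Q.X * t) := by
      rw [← ht, hc]; ring
    rw [e3] at e2
    rw [sgp, hv2]
    linear_combination (-(Q.X ^ j * p + Q.X ^ (j + 1) * h)) * e2 -
      (-(Q.X ^ (j + k + 1) * p * h') + Q.X ^ (j + k + 1) * (1 + Q.X * u2) * (p + Q.X * h) * (h' + Q.X * d')
       + Q.X ^ (j + k + 3) * Q.e * (1 + Q.X * t) * (p + Q.X * h) * Q.sg p') * h2
  · intro hk
    have ht := ht0 hk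
    subst ht
    have h1 := Q.ep_a'
    subst hw hu1 hv hu2 hv2
    simp only [map_add, map_mul, map_pow, Q.epX, hd0, hd0', h1, Q.epsg, map_one, map_zero]
    constructor <;> ring

theorem Lv.mul {Q : QM K A R N} {j α β α' β' z z'} (h : Q.Lv j α β z) (h' : Q.Lv 0 α' β' z') :
    Q.Lv (j + 1) (β * α' + α * β') ((α + β) * β') (z * z') := by
  obtain ⟨p, h, rfl, rfl, rfl⟩ := h
  obtain ⟨p', h', rfl, rfl, rfl⟩ := h'
  obtain ⟨q, r, e, hh⟩ := Q.mul_aux j 0 p h p' h'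
  obtain ⟨h1, h2⟩ := hh rfl
  exact ⟨q, r, h1, h2, e⟩

theorem M.mul {Q : QM K A R N} {j k z z'} (h : Q.M j z) (h' : Q.M k z') :
    Q.M (j + k + 1) (z * z') := by
  obtain ⟨p, h, rfl⟩ := h
  obtain ⟨p', h', rfl⟩ := h'
  obtain ⟨q, r, e, -⟩ := Q.mul_aux j k p h p' h'
  exact ⟨q, r, e⟩

theorem unit_cancel {g D : R} (hg : Q.ep g ≠ 0) (h : g * D = 0) : D = 0 := by
  obtain ⟨s, hs⟩ := Q.loc g
  have hu : IsUnit g := by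
    rw [hs]
    have h1 : IsUnit (algebraMap K R (Q.ep g)) := (IsUnit.mk0 _ hg).map _
    have h2 : IsNilpotent (Q.X * s) := ⟨N, by rw [mul_pow, Q.XN, zero_mul]⟩
    exact IsNilpotent.isUnit_add_left_of_commute h2 h1 (Commute.all _ _)
  exact (hu.mul_right_eq_zero).1 h

/-- The trace function: coefficient at the central involution. -/
def tr (z : A) : K := Q.mu (Q.Phi.symm z).1

theorem tr_comm (z z' : A) : Q.tr (z * z') = Q.tr (z' * z) := by
  obtain ⟨⟨f, g⟩, rfl⟩ := Q.Phi.surjective z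
  obtain ⟨⟨f', g'⟩, rfl⟩ := Q.Phi.surjective z'
  simp only [tr, Q.mul, LinearEquiv.symm_apply_apply, map_add]
  rw [mul_comm f f', ← Q.musg (Q.c * (g * Q.sg g'))]
  simp only [map_mul, Q.sgsg, Q.sgc]
  rw [mul_comm (Q.sg g) g']

theorem sq_formula {α β z} (h : Q.Lv 0 α β z) (hα : α ≠ 0) : ∃ f g, Q.ep g ≠ 0 ∧
    Q.ep g = α ∧
    z * z = Q.Phi (f ^ 2 + Q.c * (g * Q.sg g), g * (f + Q.sg f)) := by
  obtain ⟨p, h, rfl, rfl, rfl⟩ := h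
  refine ⟨p, p + Q.X * h, by simpa [Q.epX] using hα, by simp [Q.epX], ?_⟩
  rw [Q.mul]
  congr 1
  ext
  · simp; ring
  · simp; ring

theorem tr_sq {α β z} (h : Q.Lv 0 α β z) (hα : α ≠ 0) (hN : 2 ≤ N)
    (hz : Q.M (N - 2) (z * z)) : Q.tr (z * z) ≠ 0 := by
  obtain ⟨f, g, hg, -, e⟩ := Q.sq_formula h hα
  rw [e] at hz ⊢
  obtain ⟨p, r, e⟩ := hz
  have e := Q.Phi.injective e
  simp only [Prod.mk.injEq] at e
  have h1 : g * (Q.X ^ 2 * (f + Q.sg f)) = 0 := by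
    have h3 : Q.X ^ 2 * Q.X ^ (N - 2) = 0 := by
      rw [← pow_add, show 2 + (N - 2) = N by omega, Q.XN]
    have e2 := e.2
    linear_combination Q.X ^ 2 * e2 + (p + Q.X * r) * h3
  have h2 := Q.H1 f g (Q.unit_cancel hg h1)
  simp only [tr, LinearEquiv.symm_apply_apply, h2]
  exact pow_ne_zero _ hg

theorem sq_not_soc {α β z} (h : Q.Lv 0 α β z) (hα : α ≠ 0) (hN : 2 ≤ N)
    (hz : Q.M (N - 1) (z * z)) : False := by
  have ht := Q.tr_sq h hα hN (hz.mono (by omega))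
  obtain ⟨f, g, hg, -, e⟩ := Q.sq_formula h hα
  rw [e] at hz ht
  obtain ⟨p, r, e⟩ := hz
  have e := Q.Phi.injective e
  simp only [Prod.mk.injEq] at e
  have h3 : Q.X * Q.X ^ (N - 1) = 0 := by
    rw [← pow_succ', show N - 1 + 1 = N by omega, Q.XN]
  have h1 : g * (Q.X * (f + Q.sg f)) = 0 := by
    have e2 := e.2
    linear_combination Q.X * e2 + (p + Q.X * r) * h3
  have h2 := Q.H2 f (Q.unit_cancel hg h1)
  have e2 := e.2
  rw [h2, mul_zero] at e2
  have h4 : f ^ 2 + Q.c * (g * Q.sg g) = 0 := by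
    rw [e.1]
    linear_combination -e2 - r * h3
  simp [tr, h4] at ht

end QM

section Words

open Pointwise

variable {K A : Type*} [Field K] [Ring A] [Algebra K A]

theorem mem_of_mem_span {S T : Set A} (hli : LinearIndependent K ((↑) : S → A))
    (hT : ∀ t ∈ T, t = 0 ∨ t ∈ S) {u : A} (hu : u ∈ S) (hs : u ∈ Submodule.span K T) : u ∈ T := by
  by_contra hne
  have h1 : LinearIndepOn K id S := hli
  have h2 := h1.notMem_span hu
  apply h2
  rw [Set.image_id, id]
  rw [← Submodule.span_sdiff_singleton_zero] at hs
  refine Submodule.span_mono ?_ hs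
  rintro t ⟨ht, h0⟩
  refine ⟨(hT t ht).resolve_left h0, ?_⟩
  rintro rfl
  exact hne ht

theorem list_of_mem_pow {S : Set A} : ∀ {k : ℕ} {z : A}, z ∈ S ^ k →
    ∃ L : List A, L.length = k ∧ (∀ e ∈ L, e ∈ S) ∧ L.prod = z
  | 0, z, h => by
    rw [pow_zero, Set.mem_one] at h
    exact ⟨[], rfl, by simp, by simp [h]⟩
  | k + 1, z, h => by
    rw [pow_succ', Set.mem_mul] at h
    obtain ⟨s, hs, w, hw, rfl⟩ := h
    obtain ⟨L, h1, h2, h3⟩ := list_of_mem_pow hw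
    exact ⟨s :: L, by simp [h1], by simpa using ⟨hs, h2⟩, by simp [h3]⟩

theorem prod_mem_pow {S : Set A} : ∀ (L : List A), (∀ e ∈ L, e ∈ S) → L.prod ∈ S ^ L.length
  | [], _ => by simp
  | e :: L, h => by
    rw [List.length_cons, pow_succ', List.prod_cons]
    exact Set.mul_mem_mul (h e (by simp)) (prod_mem_pow L fun e he => h e (by simp [he]))

/-- Lists in two letters without repetition are alternating. -/
theorem alt_list (x y : A) : ∀ L : List A, (∀ e ∈ L, e = x ∨ e = y) →
    (∃ L₁ e L₂, L = L₁ ++ e :: e :: L₂) ∨ L = [] ∨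
    (∃ k L', L = x :: L' ∧ ((L.length = 2 * k + 2 ∧ L.prod = (x * y) ^ (k + 1)) ∨
      (L.length = 2 * k + 1 ∧ L.prod = x * (y * x) ^ k))) ∨
    (∃ k L', L = y :: L' ∧ ((L.length = 2 * k + 2 ∧ L.prod = (y * x) ^ (k + 1)) ∨
      (L.length = 2 * k + 1 ∧ L.prod = y * (x * y) ^ k)))
  | [], _ => by simp
  | e :: L, h => by
    rcases alt_list x y L (fun e he => h e (by simp [he])) with
      ⟨L₁, f, L₂, rfl⟩ | rfl | ⟨k, L', rfl, hh⟩ | ⟨k, L', rfl, hh⟩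
    · exact Or.inl ⟨e :: L₁, f, L₂, rfl⟩
    · right; right
      rcases h e (by simp) with rfl | rfl
      · left; exact ⟨0, [], rfl, Or.inr (by simp)⟩
      · right; exact ⟨0, [], rfl, Or.inr (by simp)⟩
    · rcases h e (by simp) with rfl | rfl
      · exact Or.inl ⟨[], e, L', rfl⟩
      · right; right; right
        rcases hh with ⟨h1, h2⟩ | ⟨h1, h2⟩
        · refine ⟨k + 1, _, rfl, Or.inr ⟨by simp at h1 ⊢; omega, ?_⟩⟩
          rw [List.prod_cons, h2]
        · refine ⟨k, _, rfl, Or.inl ⟨by simp at h1 ⊢; omega, ?_⟩⟩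
          rw [List.prod_cons, h2, ← mul_assoc, ← pow_succ']
    · rcases h e (by simp) with rfl | rfl
      · right; right; left
        rcases hh with ⟨h1, h2⟩ | ⟨h1, h2⟩
        · refine ⟨k + 1, _, rfl, Or.inr ⟨by simp at h1 ⊢; omega, ?_⟩⟩
          rw [List.prod_cons, h2]
        · refine ⟨k, _, rfl, Or.inl ⟨by simp at h1 ⊢; omega, ?_⟩⟩
          rw [List.prod_cons, h2, ← mul_assoc, ← pow_succ']
      · exact Or.inl ⟨[], e, L', rfl⟩

end Words

namespace QM

open Pointwise

variable {K A R : Type*} [Field K] [Ring A] [Algebra K A] [CommRing R] [Algebra K R]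
  {N : ℕ} (Q : QM K A R N)

theorem pow_M {S : Set A} (hS : ∀ z ∈ S, Q.M 0 z) : ∀ (k : ℕ) (z : A), z ∈ S ^ (k + 1) → Q.M k z
  | 0, z, h => by
    rw [zero_add, pow_one] at h
    exact hS z h
  | k + 1, z, h => by
    rw [pow_succ, Set.mem_mul] at h
    obtain ⟨s, hs, w, hw, rfl⟩ := h
    exact (pow_M hS k s hs).mul (hS w hw)

theorem pow_S {S : Set A} (hmul : ∀ u ∈ S, ∀ v ∈ S, u * v = 0 ∨ u * v ∈ S) :
    ∀ (k : ℕ) (z : A), z ∈ S ^ (k + 1) → z = 0 ∨ z ∈ S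
  | 0, z, h => by
    rw [zero_add, pow_one] at h
    exact Or.inr h
  | k + 1, z, h => by
    rw [pow_succ, Set.mem_mul] at h
    obtain ⟨s, hs, w, hw, rfl⟩ := h
    rcases pow_S hmul k s hs with rfl | h
    · simp
    · exact hmul s h w hw

theorem XM : Q.M 0 (Q.Phi (Q.X, 0)) := by
  refine ⟨Q.X, 1, ?_⟩
  congr 1
  ext
  · simp
  · simp only
    linear_combination (-Q.X) * Q.two

theorem M_span {S : Set A} (hspan : ∀ z, Q.M 0 z → z ∈ Submodule.span K S) :
    ∀ (k : ℕ) (z : A), Q.M k z → z ∈ Submodule.span K (S ^ (k + 1))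
  | 0, z, h => by
    rw [zero_add, pow_one]
    exact hspan z h
  | k + 1, z, h => by
    obtain ⟨p, h, rfl⟩ := h
    have e : Q.Phi (Q.X ^ (k + 1) * p, Q.X ^ (k + 1) * p + Q.X ^ (k + 1 + 1) * h) =
        Q.Phi (Q.X, 0) * Q.Phi (Q.X ^ k * p, Q.X ^ k * p + Q.X ^ (k + 1) * h) := by
      rw [Q.mul]
      congr 1
      ext <;> simp <;> ring
    rw [e, pow_succ', ← Submodule.span_mul_span]
    exact Submodule.mul_mem_mul (hspan _ Q.XM) (M_span hspan k _ ⟨p, h, rfl⟩)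

/-- Type of an element: leading coefficients proportional to `(1, t)`. -/
def Ty (k : ℕ) (t : K) (z : A) : Prop := ∃ p, p ≠ 0 ∧ Q.Lv k p (t * p) z

theorem Ty.mul {Q : QM K A R N} {k t z z'} (ht : t * t = t) (h : Q.Ty k t z)
    (h' : Q.Ty 0 (t + 1) z') : Q.Ty (k + 1) (t + 1) (z * z') := by
  obtain ⟨p, hp, h⟩ := h
  obtain ⟨p', hp', h'⟩ := h'
  refine ⟨p * p', mul_ne_zero hp hp', ?_⟩
  convert h.mul h' using 1
  · linear_combination (-t * p * p') * Q.twoK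
  · linear_combination (- p * p') * ht - t * p * p' * Q.twoK

theorem Ty.M {Q : QM K A R N} {k t z} (h : Q.Ty k t z) : Q.M k z := by
  obtain ⟨p, hp, h⟩ := h
  exact h.M

theorem Ty.notM {Q : QM K A R N} {k t z} (h : Q.Ty k t z) (hk : k < N) : ¬ Q.M (k + 1) z := by
  obtain ⟨p, hp, h⟩ := h
  intro h'
  exact hp (h.uniq1 h'.toLv hk)

theorem Ty.uniq {Q : QM K A R N} {k t t' z} (h : Q.Ty k t z) (h' : Q.Ty k t' z)
    (hk : k + 1 < N) : t = t' := by
  obtain ⟨p, hp, h⟩ := h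
  obtain ⟨p', hp', h'⟩ := h'
  obtain ⟨rfl, e⟩ := h.uniq h' hk
  exact mul_right_cancel₀ hp e

include Q in
theorem t_add (t : K) : t + 1 + 1 = t := by
  linear_combination Q.twoK

include Q in
theorem t_idem {t : K} (ht : t * t = t) : (t + 1) * (t + 1) = t + 1 := by
  linear_combination ht + t * Q.twoK

theorem Ty_words {t : K} {x y : A} (ht : t * t = t) (hx : Q.Ty 0 t x) (hy : Q.Ty 0 (t + 1) y)
    (k : ℕ) : Q.Ty (2 * k) t (x * (y * x) ^ k) ∧ Q.Ty (2 * k + 1) (t + 1) ((x * y) ^ (k + 1)) := by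
  have hx' : Q.Ty 0 (t + 1 + 1) x := by rwa [Q.t_add]
  have key : ∀ k, x * (y * x) ^ k * y = (x * y) ^ (k + 1) := by
    intro k
    induction k with
    | zero => simp
    | succ k ih => rw [pow_succ _ (k + 1), ← ih, pow_succ]; noncomm_ring
  have key2 : ∀ k, x * (y * x) ^ (k + 1) = (x * y) ^ (k + 1) * x := by
    intro k
    rw [← key, pow_succ]; noncomm_ring
  induction k with
  | zero => exact ⟨by simpa using hx, by simpa using hx.mul ht hy⟩
  | succ k ih =>
    have h1 : Q.Ty (2 * (k + 1)) t (x * (y * x) ^ (k + 1)) := by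
      rw [key2]
      have := ih.2.mul (Q.t_idem ht) hx'
      rwa [Q.t_add] at this
    refine ⟨h1, ?_⟩
    rw [← key]
    exact h1.mul ht hy

theorem sq_words {t : K} {x y : A} (ht : t * t = t) (hx : Q.Ty 0 t x) (hy : Q.Ty 0 (t + 1) y)
    (hN : 6 ≤ N)
    (hxx : x * x = 0 ∨ ∃ k, 1 ≤ k ∧ (x * x = x * (y * x) ^ k ∨ x * x = y * (x * y) ^ k ∨
      x * x = (x * y) ^ (k + 1) ∨ x * x = (y * x) ^ (k + 1))) :
    Q.M (N - 2) (x * x) ∧ ∃ k, N - 2 ≤ 2 * k ∧ x * x = y * (x * y) ^ k := by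
  have hx' : Q.Ty 0 (t + 1 + 1) x := by rwa [Q.t_add]
  have Wx := Q.Ty_words ht hx hy
  have Wy := Q.Ty_words (Q.t_idem ht) hy hx'
  have soc : ¬ Q.M (N - 1) (x * x) := by
    obtain ⟨p, hp, h⟩ := hx
    exact fun hz => Q.sq_not_soc h hp (by omega) hz
  rcases hxx with h0 | ⟨k, hk, hh | hh | hh | hh⟩
  · exact absurd (h0 ▸ Q.M_zero _) soc
  · exfalso
    obtain ⟨j, rfl⟩ : ∃ j, k = j + 1 := ⟨k - 1, by omega⟩
    obtain ⟨v, hv⟩ : ∃ v, v = (y * x) ^ j * y := ⟨_, rfl⟩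
    have hv' : Q.M 0 v := by
      have : v = y * (x * y) ^ j := by
        rw [hv]
        clear hh hv
        induction j with
        | zero => simp
        | succ j ih => rw [pow_succ', mul_assoc, ih (by omega), pow_succ']; noncomm_ring
      rw [this]
      exact (Wy j).1.M.mono (by omega)
    have e : x * x = x * v * x := by
      rw [hh, hv, pow_succ]; noncomm_ring
    have hm : Q.M 1 (x * v) := hx.M.mul hv'
    obtain ⟨p, hp, h⟩ := hx
    have h3 := h.add hm.toLv
    refine Q.sq_not_soc h3 (by simpa using hp) (by omega) ?_
    have : (x + x * v) * (x + x * v) = 0 := by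
      have e2 : (2 : A) = 0 := by
        have := congrArg (algebraMap K A) Q.twoK
        rwa [map_ofNat, map_zero] at this
      have e3 : x * x + x * v * x = 0 := by
        rw [← e, ← two_mul, e2, zero_mul]
      calc (x + x * v) * (x + x * v) = (x * x + x * v * x) * (1 + v) := by noncomm_ring
        _ = 0 := by rw [e3, zero_mul]
    rw [this]
    exact Q.M_zero _
  · have hM : Q.M (2 * k) (x * x) := hh ▸ (Wy k).1.M
    by_cases hlt : 2 * k + 2 < N
    · exfalso
      have e1 : x * (x * x) = (x * y) ^ (k + 1) := by
        rw [hh, ← mul_assoc, ← pow_succ']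
      have e2 : (x * x) * x = (y * x) ^ (k + 1) := by
        rw [hh]
        clear * -
        induction k with
        | zero => simp
        | succ j ih => rw [pow_succ', pow_succ' _ (j + 1), ← ih]; noncomm_ring
      have h1 := (Wx k).2
      have h2 := (Wy k).2
      rw [← e1, ← mul_assoc, e2] at h1
      have := h1.uniq h2 (by omega)
      exact one_ne_zero (α := K) (by linear_combination -this)
    · exact ⟨hM.mono (by omega), k, by omega, hh⟩
  · exfalso
    have hM : Q.M (2 * k + 1) (x * x) := hh ▸ (Wx k).2.M
    have hlt : 2 * k + 2 < N := by
      by_contra hcon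
      exact soc (hM.mono (by omega))
    have h1 := (Wx (k + 1)).1
    refine h1.notM (by omega) ?_
    have e1 : x * (y * x) ^ (k + 1) = (x * x) * (y * (x * y) ^ k) := by
      have e2 : x * (y * x) ^ (k + 1) = (x * y) ^ (k + 1) * x := by
        clear * -
        induction k with
        | zero => simp [mul_assoc]
        | succ j ih => rw [pow_succ, ← mul_assoc, ih, pow_succ _ (j + 1)]; noncomm_ring
      calc x * (y * x) ^ (k + 1) = (x * x) * x := by rw [e2, ← hh]
        _ = x * (x * x) := mul_assoc _ _ _
        _ = x * ((x * y) * (x * y) ^ k) := by rw [← pow_succ', ← hh]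
        _ = _ := by simp only [mul_assoc]
    rw [e1]
    exact (hM.mul (Wy k).1.M).mono (by omega)
  · exfalso
    have hM : Q.M (2 * k + 1) (x * x) := hh ▸ (Wy k).2.M
    have hlt : 2 * k + 2 < N := by
      by_contra hcon
      exact soc (hM.mono (by omega))
    have h1 := (Wx (k + 1)).1
    refine h1.notM (by omega) ?_
    have e1 : x * (y * x) ^ (k + 1) = (y * (x * y) ^ k) * (x * x) := by
      have e2 : (y * x) ^ (k + 1) = y * (x * y) ^ k * x := by
        clear * -
        induction k with
        | zero => simp
        | succ j ih => rw [pow_succ', ih, pow_succ']; noncomm_ring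
      calc x * (y * x) ^ (k + 1) = x * (x * x) := by rw [← hh]
        _ = (x * x) * x := (mul_assoc _ _ _).symm
        _ = (y * (x * y) ^ k * x) * x := by rw [← e2, ← hh]
        _ = _ := mul_assoc _ _ _
    rw [e1]
    exact ((Wy k).1.M.mul hM).mono (by omega)

/-- The main contradiction once two generators of different types are found. -/
theorem final {t : K} {x y : A} (ht : t * t = t) (hx : Q.Ty 0 t x) (hy : Q.Ty 0 (t + 1) y)
    (hN : 6 ≤ N)
    (hxx : x * x = 0 ∨ ∃ k, 1 ≤ k ∧ (x * x = x * (y * x) ^ k ∨ x * x = y * (x * y) ^ k ∨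
      x * x = (x * y) ^ (k + 1) ∨ x * x = (y * x) ^ (k + 1)))
    (hyy : y * y = 0 ∨ ∃ k, 1 ≤ k ∧ (y * y = y * (x * y) ^ k ∨ y * y = x * (y * x) ^ k ∨
      y * y = (y * x) ^ (k + 1) ∨ y * y = (x * y) ^ (k + 1))) : False := by
  have hx' : Q.Ty 0 (t + 1 + 1) x := by rwa [Q.t_add]
  obtain ⟨h1, k, hk, e⟩ := Q.sq_words ht hx hy hN hxx
  obtain ⟨h2, -⟩ := Q.sq_words (Q.t_idem ht) hy hx' hN hyy
  obtain ⟨j, rfl⟩ : ∃ j, k = j + 1 := ⟨k - 1, by omega⟩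
  have h3 : Q.tr (x * x) ≠ 0 := by
    obtain ⟨p, hp, h⟩ := hx
    exact Q.tr_sq h hp (by omega) h1
  apply h3
  rw [e, pow_succ]
  have e1 : y * ((x * y) ^ j * (x * y)) = (y * (x * y) ^ j * x) * y := by noncomm_ring
  rw [e1, Q.tr_comm]
  have e2 : y * (y * (x * y) ^ j * x) = (y * y) * ((x * y) ^ j * x) := by noncomm_ring
  have e3 : (x * y) ^ j * x = x * (y * x) ^ j := by
    clear * -
    induction j with
    | zero => simp
    | succ j ih => rw [pow_succ', mul_assoc, ih, pow_succ']; noncomm_ring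
  have h4 := (h2.mul (Q.Ty_words ht hx hy j).1.M).zero (by omega)
  rw [e2, e3, h4]
  simp [tr]

section Basis

variable {S : Set A} (hli : LinearIndependent K ((↑) : S → A))
  (hmul : ∀ u ∈ S, ∀ v ∈ S, u * v = 0 ∨ u * v ∈ S)
  (hspan : ∀ z, z ∈ Submodule.span K S ↔ Q.M 0 z)

include hspan in
theorem S_M {z : A} (hz : z ∈ S) : Q.M 0 z := (hspan z).1 (Submodule.subset_span hz)

include hspan in
theorem exists_gens (hN : 6 ≤ N) : ∃ x ∈ S, ∃ y ∈ S, ∃ p h p' h', Q.Lv 0 p h x ∧ Q.Lv 0 p' h' y ∧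
    p * h' + p' * h ≠ 0 := by
  have V : Q.Lv 0 1 0 (Q.Phi (1, 1)) := ⟨1, 0, by simp, by simp, by simp⟩
  have U : Q.Lv 0 0 1 (Q.Phi (0, Q.X)) := ⟨0, 1, by simp, by simp, by simp⟩
  by_contra hcon
  push Not at hcon
  obtain ⟨x, hxS, p, h, hx, hne⟩ : ∃ x ∈ S, ∃ p h, Q.Lv 0 p h x ∧ ¬ (p = 0 ∧ h = 0) := by
    by_contra hcon2
    push Not at hcon2
    have : ∀ z ∈ Submodule.span K S, Q.Lv 0 0 0 z := by
      intro z hz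
      induction hz using Submodule.span_induction with
      | mem z hz =>
        obtain ⟨α, β, h⟩ := (Q.S_M hspan hz).Lv
        obtain ⟨rfl, rfl⟩ := hcon2 z hz α β h
        exact h
      | zero => exact (Q.M_zero 1).toLv
      | add z z' _ _ h h' => simpa using h.add h'
      | smul t z _ h => simpa using h.smul t
    have h1 := (this _ ((hspan _).2 V.M)).uniq V (by omega)
    exact one_ne_zero h1.1.symm
  have : ∀ z ∈ Submodule.span K S, ∃ p' h', Q.Lv 0 p' h' z ∧ p * h' + p' * h = 0 := by
    intro z hz
    induction hz using Submodule.span_induction with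
    | mem z hz =>
      obtain ⟨α, β, h'⟩ := (Q.S_M hspan hz).Lv
      exact ⟨α, β, h', hcon x hxS z hz p h α β hx h'⟩
    | zero => exact ⟨0, 0, (Q.M_zero 1).toLv, by simp⟩
    | add z z' _ _ h h' =>
      obtain ⟨a1, b1, h1, e1⟩ := h
      obtain ⟨a2, b2, h2, e2⟩ := h'
      exact ⟨_, _, h1.add h2, by linear_combination e1 + e2⟩
    | smul t z _ h =>
      obtain ⟨a1, b1, h1, e1⟩ := h
      exact ⟨_, _, h1.smul t, by linear_combination t * e1⟩
  obtain ⟨a1, b1, h1, e1⟩ := this _ ((hspan _).2 V.M)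
  obtain ⟨a2, b2, h2, e2⟩ := this _ ((hspan _).2 U.M)
  obtain ⟨rfl, rfl⟩ := h1.uniq V (by omega)
  obtain ⟨rfl, rfl⟩ := h2.uniq U (by omega)
  apply hne
  constructor
  · simpa using e2
  · simpa using e1

include hli hmul hspan in
theorem mem_pow_of_M {k : ℕ} {u : A} (hu : u ∈ S) (hM : Q.M k u) : u ∈ S ^ (k + 1) :=
  mem_of_mem_span hli (pow_S hmul k) hu (Q.M_span (fun z hz => (hspan z).2 hz) k u hM)

include hli hmul hspan in
/-- squares of generators lie deep -/
theorem gen_type (hN : 6 ≤ N) {x y : A} (hxS : x ∈ S) (hyS : y ∈ S) {p h p' h' : K}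
    (hx : Q.Lv 0 p h x) (hy : Q.Lv 0 p' h' y) (hdet : p * h' + p' * h ≠ 0) :
    (p + h) * h = 0 := by
  by_contra hne
  have hS := fun z (hz : z ∈ S) => Q.S_M hspan hz
  have hxx := hx.mul hx
  have hxy := hx.mul hy
  have hyx := hy.mul hx
  have hxx0 : h * p + p * h = 0 := by linear_combination p * h * Q.twoK
  rw [hxx0] at hxx
  have hxy0 : x * y ≠ 0 := by
    intro h0
    rw [h0] at hxy
    exact hdet (by linear_combination hxy.zero1 (by omega))
  have hxyS := (hmul x hxS y hyS).resolve_left hxy0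
  obtain ⟨t, ht⟩ : ∃ t, t = ((p + h) * h)⁻¹ * (p * h' + p' * h) := ⟨_, rfl⟩
  have ht' : t * ((p + h) * h) = p * h' + p' * h := by
    rw [ht, mul_comm, ← mul_assoc, mul_inv_cancel₀ hne, one_mul]
  have hrel := ((hxx.smul t).add hxy).add hyx
  have hrel : Q.Lv 1 0 0 (t • (x * x) + x * y + y * x) := by
    convert hrel using 1
    · linear_combination (-(p * h' + p' * h)) * Q.twoK
    · linear_combination - ht' - (p * h' + p' * h + h * h') * Q.twoK
  have hmem := Q.M_span (fun z hz => (hspan z).2 hz) 2 _ hrel.succ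
  have key : x * y ∈ ({x * x, y * x} ∪ S ^ (2 + 1) : Set A) := by
    refine mem_of_mem_span hli ?_ hxyS ?_
    · rintro z ((rfl | rfl) | hz)
      · exact hmul _ hxS _ hxS
      · exact hmul _ hyS _ hxS
      · exact pow_S hmul 2 z hz
    · have e : x * y = (t • (x * x) + x * y + y * x) - t • (x * x) - y * x := by abel
      rw [e]
      refine Submodule.sub_mem _ (Submodule.sub_mem _ ?_ (Submodule.smul_mem _ _ ?_)) ?_
      · exact Submodule.span_mono Set.subset_union_right hmem
      · exact Submodule.subset_span (Or.inl (Or.inl rfl))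
      · exact Submodule.subset_span (Or.inl (Or.inr rfl))
  rcases key with (e | e) | e
  · rw [e] at hxy
    exact hdet (by linear_combination hxy.uniq1 hxx (by omega))
  · rw [e] at hxy
    exact hdet (by linear_combination (hxy.uniq hyx (by omega)).2 + (p' * h) * Q.twoK)
  · have := (Q.pow_M hS 2 _ e).toLv
    exact hdet (by linear_combination hxy.uniq1 this (by omega))

include hli hmul hspan in
theorem two_gens (hN : 6 ≤ N) {x y : A} (hxS : x ∈ S) (hyS : y ∈ S) {p h p' h' : K}
    (hx : Q.Lv 0 p h x) (hy : Q.Lv 0 p' h' y) (hdet : p * h' + p' * h ≠ 0)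
    {u : A} (hu : u ∈ S) (hu1 : ¬ Q.M 1 u) : u = x ∨ u = y := by
  have hS := fun z (hz : z ∈ S) => Q.S_M hspan hz
  obtain ⟨α, β, hL⟩ := (hS u hu).Lv
  obtain ⟨d, hd⟩ : ∃ d, d = p * h' + p' * h := ⟨_, rfl⟩
  rw [← hd] at hdet
  have hrel := (hL.add (hx.smul (d⁻¹ * (α * h' + β * p')))).add
    (hy.smul (d⁻¹ * (α * h + β * p)))
  have hrel : Q.Lv 0 0 0 (u + (d⁻¹ * (α * h' + β * p')) • x + (d⁻¹ * (α * h + β * p)) • y) := by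
    have hdd : d⁻¹ * d = 1 := inv_mul_cancel₀ hdet
    have h2 := Q.twoK
    convert hrel using 1
    · linear_combination (-α) * hdd + d⁻¹ * α * hd - (α + d⁻¹ * β * p * p') * h2
    · linear_combination (-β) * hdd + d⁻¹ * β * hd - (β + d⁻¹ * α * h * h') * h2
  have hmem := Q.M_span (fun z hz => (hspan z).2 hz) 1 _ hrel.succ
  have key : u ∈ ({x, y} ∪ S ^ (1 + 1) : Set A) := by
    refine mem_of_mem_span hli ?_ hu ?_
    · rintro z ((rfl | rfl) | hz)
      · exact Or.inr hxS
      · exact Or.inr hyS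
      · exact pow_S hmul 1 z hz
    · obtain ⟨c1, hc1⟩ : ∃ c, c = (d⁻¹ * (α * h' + β * p')) := ⟨_, rfl⟩
      obtain ⟨c2, hc2⟩ : ∃ c, c = (d⁻¹ * (α * h + β * p)) := ⟨_, rfl⟩
      rw [← hc1, ← hc2] at hmem
      have e : u = (u + c1 • x + c2 • y) - c1 • x - c2 • y := by abel
      rw [e]
      refine Submodule.sub_mem _ (Submodule.sub_mem _ ?_ (Submodule.smul_mem _ _ ?_))
        (Submodule.smul_mem _ _ ?_)
      · exact Submodule.span_mono Set.subset_union_right hmem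
      · exact Submodule.subset_span (Or.inl (Or.inl rfl))
      · exact Submodule.subset_span (Or.inl (Or.inr rfl))
  rcases key with (e | e) | e
  · exact Or.inl e
  · exact Or.inr e
  · exact absurd (Q.pow_M hS 1 _ e) hu1

include hli hmul hspan in
/-- Every basis element of the radical is an alternating word. -/
theorem words {x y : A} (hxx : Q.M 2 (x * x)) (hyy : Q.M 2 (y * y))
    (hgen : ∀ u ∈ S, ¬ Q.M 1 u → u = x ∨ u = y) {u : A} (hu : u ∈ S) :
    ∃ L : List A, L.prod = u ∧ (∀ e ∈ L, e = x ∨ e = y) ∧ (∀ L' : List A,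
      (∀ e ∈ L', e ∈ S) → L'.prod = u → L'.length ≤ L.length) ∧
      ¬ (∃ L₁ e L₂, L = L₁ ++ e :: e :: L₂) := by
  classical
  have hS := fun z (hz : z ∈ S) => Q.S_M hspan hz
  have hu0 : u ≠ 0 := by
    rintro rfl
    exact hli.ne_zero ⟨0, hu⟩ rfl
  have hbound : ∀ L : List A, (∀ e ∈ L, e ∈ S) → L.prod = u → L.length ≤ N := by
    intro L hL hp
    by_contra hcon
    obtain ⟨k, hk⟩ : ∃ k, L.length = k + 1 := ⟨L.length - 1, by omega⟩
    have h1 := prod_mem_pow L hL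
    rw [hk, hp] at h1
    exact hu0 ((Q.pow_M hS k u h1).zero (by omega))
  obtain ⟨l, ⟨L, hLl, hLS, hLp⟩, hmax⟩ : ∃ l, (∃ L : List A, L.length = l ∧ (∀ e ∈ L, e ∈ S) ∧
      L.prod = u) ∧ ∀ l', (∃ L : List A, L.length = l' ∧ (∀ e ∈ L, e ∈ S) ∧ L.prod = u) → l' ≤ l := by
    let P : ℕ → Prop := fun l => ∃ L : List A, L.length = l ∧ (∀ e ∈ L, e ∈ S) ∧ L.prod = u
    have hP1 : P 1 := ⟨[u], rfl, by simpa using hu, by simp⟩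
    have hPN : ∀ l, P l → l ≤ N := by
      rintro l ⟨L, rfl, h1, h2⟩
      exact hbound L h1 h2
    refine ⟨Nat.findGreatest P N, Nat.findGreatest_spec (hPN 1 hP1) hP1, ?_⟩
    intro l' hl'
    exact Nat.le_findGreatest (hPN l' hl') hl'
  have hmax' : ∀ L' : List A, (∀ e ∈ L', e ∈ S) → L'.prod = u → L'.length ≤ L.length := by
    intro L' h1 h2
    rw [hLl]
    exact hmax _ ⟨L', rfl, h1, h2⟩
  have hxy : ∀ e ∈ L, e = x ∨ e = y := by
    intro e he
    by_contra hcon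
    have hM : Q.M 1 e := by
      by_contra h1
      exact hcon (hgen e (hLS e he) h1)
    obtain ⟨L0, h1, h2, h3⟩ := list_of_mem_pow (Q.mem_pow_of_M hli hmul hspan (hLS e he) hM)
    obtain ⟨L₁, L₂, rfl⟩ := List.append_of_mem he
    have := hmax' (L₁ ++ (L0 ++ L₂)) ?_ ?_
    · simp [h1] at this; omega
    · intro f hf
      simp only [List.mem_append] at hf
      rcases hf with hf | hf | hf
      · exact hLS f (by simp [hf])
      · exact h2 f hf
      · exact hLS f (by simp [hf])
    · rw [← hLp]; simp [h3]
  refine ⟨L, hLp, hxy, hmax', ?_⟩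
  rintro ⟨L₁, e, L₂, rfl⟩
  have heS : e ∈ S := hLS e (by simp)
  have hM : Q.M 2 (e * e) := by
    rcases hxy e (by simp) with rfl | rfl
    · exact hxx
    · exact hyy
  have hne : e * e ≠ 0 := by
    intro h0
    apply hu0
    rw [← hLp]
    simp [← mul_assoc e e, h0]
  have heeS := (hmul e heS e heS).resolve_left hne
  obtain ⟨L0, h1, h2, h3⟩ := list_of_mem_pow (Q.mem_pow_of_M hli hmul hspan heeS hM)
  have := hmax' (L₁ ++ (L0 ++ L₂)) ?_ ?_
  · simp [h1] at this; omega
  · intro f hf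
    simp only [List.mem_append] at hf
    rcases hf with hf | hf | hf
    · exact hLS f (by simp [hf])
    · exact h2 f hf
    · exact hLS f (by simp [hf])
  · rw [← hLp]; simp [h3, mul_assoc]

include hli hmul hspan in
theorem sq_form {x y : A} (hxS : x ∈ S) (hxx : Q.M 2 (x * x))
    (hyy : Q.M 2 (y * y))
    (hgen : ∀ u ∈ S, ¬ Q.M 1 u → u = x ∨ u = y) :
    x * x = 0 ∨ ∃ k, 1 ≤ k ∧ (x * x = x * (y * x) ^ k ∨ x * x = y * (x * y) ^ k ∨
      x * x = (x * y) ^ (k + 1) ∨ x * x = (y * x) ^ (k + 1)) := by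
  rcases hmul x hxS x hxS with h0 | hS
  · exact Or.inl h0
  right
  obtain ⟨L, h1, h2, h3, h4⟩ := Q.words hli hmul hspan hxx hyy hgen hS
  obtain ⟨L0, g1, g2, g3⟩ := list_of_mem_pow (Q.mem_pow_of_M hli hmul hspan hS hxx)
  have hlen := h3 L0 g2 g3
  rw [g1] at hlen
  rcases alt_list x y L h2 with h | h | ⟨k, L', -, h | h⟩ | ⟨k, L', -, h | h⟩
  · exact absurd h h4
  · rw [h] at hlen; simp at hlen
  · exact ⟨k, by omega, Or.inr (Or.inr (Or.inl (h1.symm.trans h.2)))⟩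
  · exact ⟨k, by omega, Or.inl (h1.symm.trans h.2)⟩
  · exact ⟨k, by omega, Or.inr (Or.inr (Or.inr (h1.symm.trans h.2)))⟩
  · exact ⟨k, by omega, Or.inr (Or.inl (h1.symm.trans h.2))⟩

include hli hmul hspan in
theorem no_basis (hN : 6 ≤ N) : False := by
  obtain ⟨x, hxS, y, hyS, p, h, p', h', hx, hy, hdet⟩ := Q.exists_gens hspan hN
  have hdet' : p' * h + p * h' ≠ 0 := by rwa [add_comm]
  have tx := Q.gen_type hli hmul hspan hN hxS hyS hx hy hdet
  have ty := Q.gen_type hli hmul hspan hN hyS hxS hy hx hdet'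
  have hgen := fun u hu hu1 => Q.two_gens hli hmul hspan hN hxS hyS hx hy hdet (u := u) hu hu1
  have hxx : Q.M 2 (x * x) := by
    have := hx.mul hx
    rw [tx, show h * p + p * h = 0 by linear_combination p * h * Q.twoK] at this
    exact this.succ
  have hyy : Q.M 2 (y * y) := by
    have := hy.mul hy
    rw [ty, show h' * p' + p' * h' = 0 by linear_combination p' * h' * Q.twoK] at this
    exact this.succ
  have fx := Q.sq_form hli hmul hspan hxS hxx hyy hgen
  have fy := Q.sq_form hli hmul hspan hyS hyy hxx (fun u hu hu1 => (hgen u hu hu1).symm)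
  have h2 := Q.twoK
  rcases mul_eq_zero.1 tx with ex | ex <;> rcases mul_eq_zero.1 ty with ey | ey
  · exact hdet (by linear_combination p' * ex + p * ey - p * p' * h2)
  · subst ey
    rw [mul_zero, zero_add] at hdet
    have hh : h = p := by linear_combination ex - p * h2
    subst hh
    refine Q.final (t := 1) (one_mul 1) (x := x) (y := y)
      ⟨h, right_ne_zero_of_mul hdet, by simpa using hx⟩
      ⟨p', left_ne_zero_of_mul hdet, ?_⟩ hN fx fy
    rwa [show (1 + 1 : K) = 0 by linear_combination h2, zero_mul]
  · subst ex
    rw [mul_zero, add_zero] at hdet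
    have hh : h' = p' := by linear_combination ey - p' * h2
    subst hh
    refine Q.final (t := 0) (zero_mul 0) (x := x) (y := y)
      ⟨p, left_ne_zero_of_mul hdet, by simpa using hx⟩
      ⟨h', right_ne_zero_of_mul hdet, by simpa using hy⟩ hN fx fy
  · subst ex ey
    simp at hdet

end Basis

end QM

set_option linter.unusedSectionVars false

namespace CycAlg

open MonoidAlgebra

variable {K : Type*} [Field K] [CharP K 2] {H : Type*} [CommGroup H]

/-- Augmentation. -/
noncomputable def ep : MonoidAlgebra K H →ₐ[K] K := MonoidAlgebra.lift K K H 1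

/-- Inversion on the group algebra. -/
noncomputable def sg : MonoidAlgebra K H →ₐ[K] MonoidAlgebra K H :=
  MonoidAlgebra.mapDomainAlgHom K K (invMonoidHom : H →* H)

/-- The coefficient functional. -/
noncomputable def cf (h : H) : MonoidAlgebra K H →ₗ[K] K where
  toFun x := x.coeff h
  map_add' x y := by simp
  map_smul' x y := by simp

theorem ep_single (h : H) (r : K) : ep (single h r) = r := by simp [ep]

theorem sg_single (h : H) (r : K) : sg (single h r) = single h⁻¹ r := by simp [sg]

theorem cf_single_mul (h g : H) (x : MonoidAlgebra K H) :
    cf h (single g 1 * x) = cf (g⁻¹ * h) x := by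
  change (single g 1 * x).coeff h = x.coeff (g⁻¹ * h)
  rw [coeff_single_mul_apply, one_mul]

theorem cf_single (h g : H) (r : K) [Decidable (g = h)] : cf h (single g r) = if g = h then r else 0 := by
  change (single g r).coeff h = _
  rw [coeff_single, Finsupp.single_apply]

theorem ext_cf {x y : MonoidAlgebra K H} (h : ∀ g, cf g x = cf g y) : x = y := by
  apply MonoidAlgebra.ext
  apply Finsupp.ext
  intro g
  exact h g

theorem cf_sg (h : H) (x : MonoidAlgebra K H) : cf h (sg x) = cf h⁻¹ x := by
  classical
  induction x using MonoidAlgebra.induction_linear with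
  | zero => simp
  | add x y hx hy => simp [hx, hy]
  | single g r =>
    rw [sg_single, cf_single, cf_single]
    simp [inv_eq_iff_eq_inv]

theorem sgsg (x : MonoidAlgebra K H) : sg (sg x) = x := by
  apply ext_cf
  intro g
  rw [cf_sg, cf_sg, inv_inv]

theorem epsg (x : MonoidAlgebra K H) : ep (sg x) = ep x := by
  induction x using MonoidAlgebra.induction_linear with
  | zero => simp
  | add x y hx hy => simp [hx, hy]
  | single g r => rw [sg_single, ep_single, ep_single]

instance : CharP (MonoidAlgebra K H) 2 :=
  charP_of_injective_algebraMap (algebraMap K (MonoidAlgebra K H)).injective 2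

theorem cf_norm (g : MonoidAlgebra K H) : cf 1 (g * sg g) = ep g ^ 2 := by
  classical
  induction g using MonoidAlgebra.induction_linear with
  | zero => simp
  | add x y hx hy =>
    have h1 : cf 1 (x * sg y) = cf 1 (y * sg x) := by
      have := cf_sg 1 (y * sg x)
      rw [map_mul, sgsg, inv_one, mul_comm] at this
      exact this
    have h2 : (x + y) * sg (x + y) = x * sg x + y * sg y + (x * sg y + y * sg x) := by
      rw [map_add]; ring
    rw [h2, map_add, map_add, map_add, h1, CharTwo.add_self_eq_zero, hx, hy, map_add,
      CharTwo.add_sq, add_zero]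
  | single h r =>
    rw [sg_single, single_mul_single, ep_single, cf_single]
    simp [sq]

variable (s : H) (k : ℕ)

/-- The standard generator of the augmentation ideal. -/
noncomputable def X : MonoidAlgebra K H := single s 1 + 1

theorem cf_X_mul (h : H) (x : MonoidAlgebra K H) : cf h (X s * x) = cf (s⁻¹ * h) x + cf h x := by
  rw [X, add_mul, one_mul, map_add, cf_single_mul]

theorem X_pow_two_pow (j : ℕ) : (X s : MonoidAlgebra K H) ^ 2 ^ j = single (s ^ 2 ^ j) 1 + 1 := by
  rw [X, add_pow_char_pow, single_pow, one_pow, one_pow]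

theorem sgX : sg (X s : MonoidAlgebra K H) = single s⁻¹ 1 * X s := by
  rw [X, map_add, map_one, sg_single, mul_add, single_mul_single, inv_mul_cancel, mul_one, mul_one,
    ← one_def, add_comm]

theorem cf_pow (hs : orderOf s = 4 * 2 ^ k) (i : ℕ) : ∀ j, i ≤ j → j < 4 * 2 ^ k →
    cf (s ^ j) ((X s : MonoidAlgebra K H) ^ i) = if j = i then 1 else 0 := by
  classical
  induction i with
  | zero =>
    intro j _ hj
    rw [pow_zero, one_def, cf_single]
    by_cases h : j = 0
    · subst h; simp
    · rw [if_neg h, if_neg]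
      intro h'
      have := orderOf_dvd_of_pow_eq_one h'.symm
      rw [hs] at this
      exact h (Nat.eq_zero_of_dvd_of_lt this hj)
  | succ i ih =>
    intro j hij hj
    obtain ⟨j, rfl⟩ : ∃ l, j = l + 1 := ⟨j - 1, by omega⟩
    rw [pow_succ' (X s), cf_X_mul, ih (j + 1) (by omega) hj, pow_succ', inv_mul_cancel_left,
      ih j (by omega) (by omega), if_neg (show ¬ (j + 1 = i) by omega)]
    simp

theorem XN1 (hs : orderOf s = 4 * 2 ^ k) : (X s : MonoidAlgebra K H) ^ (4 * 2 ^ k - 1) ≠ 0 := by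
  intro h
  have hk : 0 < 2 ^ k := by positivity
  have := cf_pow (K := K) s k hs (4 * 2 ^ k - 1) _ le_rfl (by omega)
  rw [h] at this
  simp at this

theorem loc (hgen : ∀ h : H, ∃ i : ℕ, h = s ^ i) (r : MonoidAlgebra K H) :
    ∃ t, r = algebraMap K _ (ep r) + X s * t := by
  induction r using MonoidAlgebra.induction_linear with
  | zero => exact ⟨0, by simp⟩
  | add x y hx hy =>
    obtain ⟨t, ht⟩ := hx
    obtain ⟨u, hu⟩ := hy
    refine ⟨t + u, ?_⟩
    rw [map_add, map_add]
    linear_combination ht + hu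
  | single h c =>
    obtain ⟨i, rfl⟩ := hgen h
    rw [ep_single]
    obtain ⟨t, ht⟩ := sub_one_dvd_pow_sub_one (single s (1 : K)) i
    refine ⟨algebraMap K _ c * t, ?_⟩
    rw [CharTwo.sub_eq_add, CharTwo.sub_eq_add, single_pow, one_pow] at ht
    have e : single (s ^ i) c = algebraMap K (MonoidAlgebra K H) c * single (s ^ i) 1 := by
      simp [single_mul_single]
    have h2 : (2 : MonoidAlgebra K H) = 0 := CharTwo.two_eq_zero
    rw [e, X]
    linear_combination algebraMap K (MonoidAlgebra K H) c * ht
      - algebraMap K (MonoidAlgebra K H) c * h2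

theorem H2 (hgen : ∀ h : H, ∃ i : ℕ, h = s ^ i) (f : MonoidAlgebra K H)
    (h : X s * (f + sg f) = 0) : f + sg f = 0 := by
  have key : ∀ i : ℕ, cf (s ^ i) (f + sg f) = 0 := by
    intro i
    induction i with
    | zero => rw [pow_zero, map_add, cf_sg, inv_one, CharTwo.add_self_eq_zero]
    | succ i ih =>
      have := congrArg (cf (s ^ (i + 1))) h
      rwa [cf_X_mul, pow_succ', inv_mul_cancel_left, ih, zero_add, map_zero, ← pow_succ'] at this
  apply ext_cf
  intro g
  obtain ⟨i, rfl⟩ := hgen g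
  rw [key, map_zero]

theorem even_coeff (f : MonoidAlgebra K H)
    (h : X s ^ 2 * (f + sg f) = 0) (i : ℕ) : cf (s ^ (2 * i)) (f + sg f) = 0 := by
  have h2 := X_pow_two_pow (K := K) s 1
  rw [pow_one] at h2
  rw [h2, add_mul, one_mul] at h
  induction i with
  | zero => rw [mul_zero, pow_zero, map_add, cf_sg, inv_one, CharTwo.add_self_eq_zero]
  | succ i ih =>
    have := congrArg (cf (s ^ (2 * (i + 1)))) h
    have e : (s ^ 2)⁻¹ * s ^ (2 * (i + 1)) = s ^ (2 * i) := by
      rw [mul_add, mul_one, add_comm, pow_add, inv_mul_cancel_left]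
    rwa [map_add, cf_single_mul, e, ih, zero_add, map_zero] at this

theorem sq_coeff (hs : orderOf s = 4 * 2 ^ k) (hgen : ∀ h : H, ∃ i : ℕ, h = s ^ i)
    (f : MonoidAlgebra K H) :
    cf (s ^ (2 * 2 ^ k)) (f ^ 2) = (cf (s ^ 2 ^ k) f + cf (s ^ 2 ^ k)⁻¹ f) ^ 2 := by
  classical
  have hk : 0 < 2 ^ k := by positivity
  have hinv : (s ^ 2 ^ k)⁻¹ = s ^ (3 * 2 ^ k) := by
    rw [inv_eq_iff_mul_eq_one, ← pow_add, ← orderOf_dvd_iff_pow_eq_one, hs]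
    exact ⟨1, by ring⟩
  have hinj : ∀ i j, i < 4 * 2 ^ k → j < 4 * 2 ^ k → (s ^ i = s ^ j ↔ i = j) := by
    intro i j hi hj
    rw [pow_inj_mod, hs, Nat.mod_eq_of_lt hi, Nat.mod_eq_of_lt hj]
  rw [hinv]
  induction f using MonoidAlgebra.induction_linear with
  | zero => simp
  | add x y hx hy =>
    rw [CharTwo.add_sq, map_add, hx, hy, map_add, map_add, ← CharTwo.add_sq]
    ring
  | single h r =>
    obtain ⟨i, rfl⟩ := hgen h
    rw [← pow_mod_orderOf s i, hs]
    have hi : i % (4 * 2 ^ k) < 4 * 2 ^ k := Nat.mod_lt _ (by omega)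
    generalize i % (4 * 2 ^ k) = i at hi
    rw [single_pow, cf_single, cf_single, cf_single, hinj _ _ hi (by omega), hinj _ _ hi (by omega),
      ← pow_mul]
    have : s ^ (i * 2) = s ^ (2 * 2 ^ k) ↔ i = 2 ^ k ∨ i = 3 * 2 ^ k := by
      rw [pow_inj_mod, hs, Nat.mod_eq_of_lt (show 2 * 2 ^ k < 4 * 2 ^ k by omega)]
      by_cases h : i * 2 < 4 * 2 ^ k
      · rw [Nat.mod_eq_of_lt h]; omega
      · rw [Nat.mod_eq_sub_mod (by omega), Nat.mod_eq_of_lt (by omega)]; omega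
    rw [if_congr this rfl rfl]
    by_cases h1 : i = 2 ^ k
    · have h2 : ¬ i = 3 * 2 ^ k := by omega
      simp [h1]
    · by_cases h2 : i = 3 * 2 ^ k
      · simp [h2]
      · simp [h1, h2]

theorem H1 (hk : 1 ≤ k) (hs : orderOf s = 4 * 2 ^ k) (hgen : ∀ h : H, ∃ i : ℕ, h = s ^ i)
    (f g : MonoidAlgebra K H) (h : X s ^ 2 * (f + sg f) = 0) :
    cf (s ^ (2 * 2 ^ k)) (f ^ 2 + single (s ^ (2 * 2 ^ k)) 1 * (g * sg g)) = ep g ^ 2 := by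
  have h1 := even_coeff s f h (2 ^ (k - 1))
  rw [← pow_succ', Nat.sub_add_cancel hk, map_add, cf_sg] at h1
  rw [map_add, sq_coeff s k hs hgen, h1, cf_single_mul, inv_mul_cancel, cf_norm]
  simp

end CycAlg

namespace QuatAlg

open MonoidAlgebra CycAlg

variable {K : Type*} [Field K] [CharP K 2] {H : Type*} [CommGroup H] {G : Type*} [Group G]

/-- The inclusion of group algebras. -/
noncomputable def emb (K : Type*) [Field K] (j : H →* G) : MonoidAlgebra K H →ₐ[K] MonoidAlgebra K G :=
  MonoidAlgebra.mapDomainAlgHom K K j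

theorem emb_single (j : H →* G) (h : H) (r : K) : emb K j (single h r) = single (j h) r := by
  simp [emb]

theorem emb_coeff {j : H →* G} (hj : Function.Injective j) (f : MonoidAlgebra K H) (h : H) :
    (emb K j f).coeff (j h) = f.coeff h := by
  simpa [emb] using Finsupp.mapDomain_apply hj f.coeff h

theorem emb_coeff_zero {j : H →* G} (f : MonoidAlgebra K H) {x : G} (hx : ∀ h, j h ≠ x) :
    (emb K j f).coeff x = 0 := by
  simpa [emb] using Finsupp.mapDomain_of_notMem_range f.coeff x (by rintro ⟨h, e⟩; exact hx h e)

/-- The linear map `(f, g) ↦ f + g b`. -/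
noncomputable def phi (K : Type*) [Field K] (j : H →* G) (b : G) :
    (MonoidAlgebra K H × MonoidAlgebra K H) →ₗ[K] MonoidAlgebra K G :=
  (emb K j).toLinearMap.coprod
    ((LinearMap.mulRight K (single b (1 : K))).comp (emb K j).toLinearMap)

theorem phi_apply (j : H →* G) (b : G) (f g : MonoidAlgebra K H) :
    phi K j b (f, g) = emb K j f + emb K j g * single b 1 := by
  simp [phi]

theorem phi_inj {j : H →* G} (hj : Function.Injective j) {b : G} (hb : ∀ h, j h ≠ b) :
    Function.Injective (phi K j b) := by
  rw [injective_iff_map_eq_zero]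
  rintro ⟨f, g⟩ h0
  rw [phi_apply] at h0
  have c1 : ∀ x, (emb K j f).coeff x + (emb K j g).coeff (x * b⁻¹) = 0 := by
    intro x
    have := congrArg (fun z => z.coeff x) h0
    simpa [coeff_mul_single_apply] using this
  have hf : f = 0 := by
    apply MonoidAlgebra.ext
    apply Finsupp.ext
    intro h
    have := c1 (j h)
    rw [emb_coeff hj, emb_coeff_zero, add_zero] at this
    · exact this
    · intro h' e
      apply hb (h'⁻¹ * h)
      rw [map_mul, map_inv, e]
      group
  have hg : g = 0 := by
    apply MonoidAlgebra.ext
    apply Finsupp.ext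
    intro h
    have := c1 (j h * b)
    rw [mul_inv_cancel_right, emb_coeff hj, hf] at this
    simpa using this
  rw [hf, hg]
  rfl

theorem phi_surj {j : H →* G} {b : G} (hG : ∀ x : G, ∃ h, x = j h ∨ x = j h * b) :
    Function.Surjective (phi K j b) := by
  intro z
  induction z using MonoidAlgebra.induction_linear with
  | zero => exact ⟨0, map_zero _⟩
  | add x y hx hy =>
    obtain ⟨u, rfl⟩ := hx
    obtain ⟨v, rfl⟩ := hy
    exact ⟨u + v, map_add _ _ _⟩
  | single x r =>
    obtain ⟨h, rfl | rfl⟩ := hG x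
    · exact ⟨(single h r, 0), by rw [phi_apply, emb_single]; simp⟩
    · exact ⟨(0, single h r), by rw [phi_apply, emb_single, single_mul_single]; simp⟩

theorem b_comm {j : H →* G} {b : G} (hbj : ∀ h, b * j h = j h⁻¹ * b) (f : MonoidAlgebra K H) :
    single b 1 * emb K j f = emb K j (sg f) * single b 1 := by
  induction f using MonoidAlgebra.induction_linear with
  | zero => simp
  | add x y hx hy => simp only [map_add, mul_add, add_mul, hx, hy]
  | single h r =>
    rw [sg_single, emb_single, emb_single, single_mul_single, single_mul_single, hbj, one_mul, mul_one]

/-- The model of the group algebra. -/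
noncomputable def model (K : Type*) [Field K] [CharP K 2] {s : H} {k : ℕ} (hk : 1 ≤ k)
    (hs : orderOf s = 4 * 2 ^ k)
    (hgen : ∀ h : H, ∃ i : ℕ, h = s ^ i) {j : H →* G} (hj : Function.Injective j) {b : G}
    (hb : ∀ h, j h ≠ b) (hG : ∀ x : G, ∃ h, x = j h ∨ x = j h * b)
    (hbj : ∀ h, b * j h = j h⁻¹ * b) (hbb : b * b = j (s ^ (2 * 2 ^ k))) :
    QM K (MonoidAlgebra K G) (MonoidAlgebra K H) (4 * 2 ^ k) where
  two := CharTwo.two_eq_zero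
  ep := ep
  sg := sg
  X := X s
  a' := single s⁻¹ 1
  c := single (s ^ (2 * 2 ^ k)) 1
  e := X s ^ (2 * 2 ^ k - 3)
  mu := cf (s ^ (2 * 2 ^ k))
  Phi := LinearEquiv.ofBijective (phi K j b) ⟨phi_inj hj hb, phi_surj hG⟩
  ha' := by
    rw [X, add_comm, add_assoc, CharTwo.add_self_eq_zero, add_zero, single_mul_single,
      mul_inv_cancel, mul_one, one_def]
  sgX := sgX s
  loc := loc s hgen
  epX := by rw [X, map_add, map_one, ep_single, CharTwo.add_self_eq_zero]
  epsg := epsg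
  XN := by
    have h4 : 4 * 2 ^ k = 2 ^ (k + 2) := by ring
    rw [h4, X_pow_two_pow, ← h4, ← hs, pow_orderOf_eq_one, ← one_def, CharTwo.add_self_eq_zero]
  XN1 := XN1 s k hs
  hc := by
    have h1 : 2 ^ 1 ≤ 2 ^ k := Nat.pow_le_pow_right (by norm_num) hk
    have h4 : 2 * 2 ^ k = 2 ^ (k + 1) := by ring
    rw [← pow_add, Nat.add_sub_cancel' (by omega), h4, X_pow_two_pow,
      add_comm (single _ _) (1 : MonoidAlgebra K H), ← add_assoc,
      CharTwo.add_self_eq_zero, zero_add]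
  sgc := by
    rw [sg_single]
    congr 1
    rw [inv_eq_iff_mul_eq_one, ← pow_add, ← orderOf_dvd_iff_pow_eq_one, hs]
    exact ⟨1, by ring⟩
  sgsg := sgsg
  musg r := by
    rw [cf_sg]
    congr 2
    rw [inv_eq_iff_mul_eq_one, ← pow_add, ← orderOf_dvd_iff_pow_eq_one, hs]
    exact ⟨1, by ring⟩
  H1 f g h := H1 s k hk hs hgen f g h
  H2 f h := H2 s hgen f h
  mul f g f' g' := by
    change phi K j b _ * phi K j b _ = phi K j b _
    have hβ : (single b 1 * single b 1 : MonoidAlgebra K G) =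
        emb K j (single (s ^ (2 * 2 ^ k)) 1) := by
      rw [single_mul_single, emb_single, hbb, mul_one]
    rw [phi_apply, phi_apply, phi_apply]
    have e1 : emb K j g * single b 1 * emb K j f' = emb K j (g * sg f') * single b 1 := by
      rw [mul_assoc, b_comm hbj, map_mul, mul_assoc]
    have e2 : emb K j g * single b 1 * (emb K j g' * single b 1) =
        emb K j (single (s ^ (2 * 2 ^ k)) 1 * (g * sg g')) := by
      rw [mul_assoc, ← mul_assoc (single b 1), b_comm hbj, mul_assoc, hβ, ← map_mul, ← map_mul]
      congr 1
      ring
    rw [add_mul, mul_add, mul_add, e1, e2, map_add, map_add, add_mul, map_mul _ f f',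
      map_mul _ f g', ← mul_assoc]
    abel

end QuatAlg

/-- The radical of the model. -/
theorem QM.mem_rad {K A R : Type*} [Field K] [Ring A] [Algebra K A] [CommRing R] [Algebra K R]
    {N : ℕ} (Q : QM K A R N) (aug : A →ₐ[K] K)
    (haug : ∀ f g, aug (Q.Phi (f, g)) = Q.ep f + Q.ep g) (z : A) :
    z ∈ ringRad A ↔ Q.M 0 z := by
  have key : ∀ z, Q.M 0 z ↔ aug z = 0 := by
    intro z
    constructor
    · rintro ⟨p, h, rfl⟩
      rw [haug]
      simp only [pow_zero, one_mul, zero_add, pow_one, map_add, map_mul, Q.epX, zero_mul, add_zero]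
      linear_combination Q.ep p * Q.twoK
    · intro hz
      obtain ⟨⟨f, g⟩, rfl⟩ := Q.Phi.surjective z
      rw [haug] at hz
      obtain ⟨t, ht⟩ := Q.loc (f + g)
      rw [map_add, hz, map_zero, zero_add] at ht
      refine ⟨f, t, ?_⟩
      congr 2
      · simp
      · simp only [pow_zero, one_mul, zero_add, pow_one, ← ht]
        linear_combination -f * Q.two
  rw [key]
  constructor
  · intro hz
    have hsurj : Function.Surjective (aug : A →+* K) := fun r => ⟨algebraMap K A r, by simp⟩
    have hmax := RingHom.ker_isMaximal_of_surjective (aug : A →+* K) hsurj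
    have : z ∈ RingHom.ker (aug : A →+* K) := by
      have h2 := Ideal.mem_sInf.1 hz
      exact h2 ⟨bot_le, hmax⟩
    simpa using this
  · intro hz
    rw [ringRad, Ideal.mem_jacobson_iff]
    intro y
    have hM : Q.M 0 (y * z) := by rw [key, map_mul, hz, mul_zero]
    have hp : ∀ k, Q.M k ((y * z) ^ (k + 1)) := by
      intro k
      induction k with
      | zero => simpa using hM
      | succ k ih =>
        rw [pow_succ]
        exact M.mul ih hM
    have hnil : IsNilpotent (y * z) := ⟨N + 1, M.zero (hp N) le_rfl⟩
    obtain ⟨u, hu⟩ := hnil.isUnit_add_one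
    refine ⟨((u⁻¹ : Aˣ) : A), ?_⟩
    have := u.inv_mul
    rw [hu, mul_add, mul_one] at this
    rw [mul_assoc, this, sub_self]
    exact Ideal.zero_mem _


theorem no_filtered {K : Type*} [Field K] [CharP K 2] {H : Type*} [CommGroup H]
    {G : Type*} [Group G] {s : H} {k : ℕ} (hk : 1 ≤ k) (hs : orderOf s = 4 * 2 ^ k)
    (hgen : ∀ h : H, ∃ i : ℕ, h = s ^ i) {j : H →* G} (hj : Function.Injective j) {b : G}
    (hb : ∀ h, j h ≠ b) (hG : ∀ x : G, ∃ h, x = j h ∨ x = j h * b)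
    (hbj : ∀ h, b * j h = j h⁻¹ * b) (hbb : b * b = j (s ^ (2 * 2 ^ k))) :
    ¬ ∃ B : Set (MonoidAlgebra K G), (∀ b₁ ∈ B, ∀ b₂ ∈ B, b₁ * b₂ = 0 ∨ b₁ * b₂ ∈ B) ∧
      LinearIndependent K ((↑) : ↥(B ∩ (ringRad (MonoidAlgebra K G) : Set (MonoidAlgebra K G))) →
        MonoidAlgebra K G) ∧
      Submodule.span K (B ∩ (ringRad (MonoidAlgebra K G) : Set (MonoidAlgebra K G))) =
        Submodule.restrictScalars K (ringRad (MonoidAlgebra K G)) := by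
  rintro ⟨B, hmul, hli, hspan⟩
  let Q := QuatAlg.model K hk hs hgen hj hb hG hbj hbb
  have haug : ∀ f g, MonoidAlgebra.lift K K G 1 (Q.Phi (f, g)) = Q.ep f + Q.ep g := by
    intro f g
    have hemb : ∀ f : MonoidAlgebra K H, MonoidAlgebra.lift K K G 1
        (QuatAlg.emb K j f) = CycAlg.ep f := by
      intro f
      induction f using MonoidAlgebra.induction_linear with
      | zero => simp
      | add x y hx hy => simp only [map_add, hx, hy]
      | single h r => rw [QuatAlg.emb_single, CycAlg.ep_single]; simp
    change MonoidAlgebra.lift K K G 1 (QuatAlg.phi K j b (f, g)) =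
      CycAlg.ep f + CycAlg.ep g
    rw [QuatAlg.phi_apply, map_add, map_mul, hemb, hemb]
    simp
  have hrad := Q.mem_rad _ haug
  refine Q.no_basis hli ?_ ?_ ?_
  · rintro u ⟨huB, -⟩ v ⟨hvB, hvR⟩
    rcases hmul u huB v hvB with h | h
    · exact Or.inl h
    · exact Or.inr ⟨h, Ideal.mul_mem_left _ u hvR⟩
  · intro z
    rw [hspan, ← hrad z]
    rfl
  · have h1 : 2 ^ 1 ≤ 2 ^ k := Nat.pow_le_pow_right (by norm_num) hk
    omega

theorem no_filtered_of_comm {K : Type*} [Field K] [CharP K 2] {H : Type*} [hH : Group H]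
    {G : Type*} [Group G]
    (comm : ∀ x y : H, x * y = y * x) {s : H} {k : ℕ} (hk : 1 ≤ k) (hs : orderOf s = 4 * 2 ^ k)
    (hgen : ∀ h : H, ∃ i : ℕ, h = s ^ i) {j : H →* G} (hj : Function.Injective j) {b : G}
    (hb : ∀ h, j h ≠ b) (hG : ∀ x : G, ∃ h, x = j h ∨ x = j h * b)
    (hbj : ∀ h, b * j h = j h⁻¹ * b) (hbb : b * b = j (s ^ (2 * 2 ^ k))) :
    ¬ ∃ B : Set (MonoidAlgebra K G), (∀ b₁ ∈ B, ∀ b₂ ∈ B, b₁ * b₂ = 0 ∨ b₁ * b₂ ∈ B) ∧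
      LinearIndependent K ((↑) : ↥(B ∩ (ringRad (MonoidAlgebra K G) : Set (MonoidAlgebra K G))) →
        MonoidAlgebra K G) ∧
      Submodule.span K (B ∩ (ringRad (MonoidAlgebra K G) : Set (MonoidAlgebra K G))) =
        Submodule.restrictScalars K (ringRad (MonoidAlgebra K G)) := by
  let : CommGroup H := { hH with mul_comm := comm }
  exact no_filtered (K := K) (H := H) hk hs hgen hj hb hG hbj hbb

theorem quat_ba {G : Type*} [Group G] {a b : G} (hconj : b * a * b⁻¹ = a⁻¹) (i : ℕ) :
    b * a ^ i = (a ^ i)⁻¹ * b := by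
  have := congrArg (· ^ i) hconj
  simp only [conj_pow] at this
  rw [← inv_pow, ← this]
  group

theorem quat_pow {G : Type*} [Group G] {a : G} {N : ℕ} (hN : 0 < N) (ha : a ^ N = 1) :
    ∀ x ∈ Subgroup.zpowers a, ∃ i : ℕ, x = a ^ i := by
  rintro x ⟨i, rfl⟩
  have hfin : IsOfFinOrder a := isOfFinOrder_iff_pow_eq_one.2 ⟨_, hN, ha⟩
  have := hfin.mem_powers_iff_mem_zpowers.2 (⟨i, rfl⟩ : a ^ i ∈ Subgroup.zpowers a)
  obtain ⟨l, hl⟩ := this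
  exact ⟨l, hl.symm⟩

theorem quat_cover {G : Type*} [Group G] {a b : G} {N m₀ : ℕ} (hN : 0 < N) (ha : a ^ N = 1)
    (hb : b ^ 2 = a ^ m₀) (hconj : b * a * b⁻¹ = a⁻¹)
    (hgen : Subgroup.closure {a, b} = (⊤ : Subgroup G)) :
    ∀ x : G, ∃ i : ℕ, x = a ^ i ∨ x = a ^ i * b := by
  have hba := quat_ba hconj
  have hpow := quat_pow hN ha
  have hinvpow : ∀ i : ℕ, ∃ l : ℕ, (a ^ i)⁻¹ = a ^ l := fun i =>
    hpow _ (inv_mem (pow_mem (Subgroup.mem_zpowers a) i))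
  intro x
  have hx : x ∈ Subgroup.closure {a, b} := by rw [hgen]; trivial
  induction hx using Subgroup.closure_induction with
  | mem x hx =>
    rcases hx with rfl | rfl
    · exact ⟨1, Or.inl (by simp)⟩
    · exact ⟨0, Or.inr (by simp)⟩
  | one => exact ⟨0, Or.inl (by simp)⟩
  | mul x y _ _ hx hy =>
    obtain ⟨i, hx⟩ := hx
    obtain ⟨l, hy⟩ := hy
    obtain ⟨m, hm⟩ := hinvpow l
    rcases hx with rfl | rfl <;> rcases hy with rfl | rfl
    · exact ⟨i + l, Or.inl (by rw [pow_add])⟩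
    · exact ⟨i + l, Or.inr (by rw [pow_add, mul_assoc])⟩
    · exact ⟨i + m, Or.inr (by rw [pow_add, mul_assoc, hba, hm, mul_assoc])⟩
    · refine ⟨i + m + m₀, Or.inl ?_⟩
      rw [pow_add, pow_add, ← hb, ← hm, mul_assoc (a ^ i), ← mul_assoc b, hba, sq]
      group
  | inv x _ hx =>
    obtain ⟨i, rfl | rfl⟩ := hx
    · obtain ⟨m, hm⟩ := hinvpow i
      exact ⟨m, Or.inl hm⟩
    · obtain ⟨m, hm⟩ := hinvpow (m₀)
      refine ⟨i + m, Or.inr ?_⟩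
      rw [inv_eq_iff_mul_eq_one, pow_add, ← hm, ← hb]
      have e : a ^ i * b * (a ^ i * (b ^ 2)⁻¹ * b) = a ^ i * (b * a ^ i) * b⁻¹ := by group
      rw [e, hba]
      group

theorem quat_order {G : Type*} [Group G] {a b : G} {k : ℕ} (hN : 0 < 4 * 2 ^ k)
    (ha : a ^ (4 * 2 ^ k) = 1) (hgen : Subgroup.closure {a, b} = (⊤ : Subgroup G))
    (hcover : ∀ x : G, ∃ i : ℕ, x = a ^ i ∨ x = a ^ i * b)
    (hcard : Nat.card G = 2 ^ (k + 2 + 1)) :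
    b ∉ Subgroup.zpowers a ∧ orderOf a = 4 * 2 ^ k := by
  have hle : orderOf a ≤ 4 * 2 ^ k := orderOf_le_of_pow_eq_one hN ha
  have : Finite G := Nat.finite_of_card_ne_zero (by rw [hcard]; positivity)
  have hnot : b ∉ Subgroup.zpowers a := by
    intro hbm
    have htop : Subgroup.zpowers a = ⊤ := by
      rw [← top_le_iff, ← hgen, Subgroup.closure_le]
      rintro x (rfl | rfl)
      · exact Subgroup.mem_zpowers _
      · exact hbm
    have := Nat.card_zpowers a
    rw [htop, Subgroup.card_top, hcard] at this
    have h8 : 2 ^ (k + 2 + 1) = 8 * 2 ^ k := by ring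
    omega
  have hord : orderOf a = 4 * 2 ^ k := by
    refine le_antisymm hle ?_
    have hsurj : Function.Surjective
        (fun p : Subgroup.zpowers a × Bool => (p.1 : G) * (if p.2 then b else 1)) := by
      intro x
      obtain ⟨i, rfl | rfl⟩ := hcover x
      · exact ⟨(⟨a ^ i, pow_mem (Subgroup.mem_zpowers a) i⟩, false), by simp⟩
      · exact ⟨(⟨a ^ i, pow_mem (Subgroup.mem_zpowers a) i⟩, true), by simp⟩
    have := Nat.card_le_card_of_surjective _ hsurj
    rw [hcard, Nat.card_prod, Nat.card_zpowers] at this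
    have h8 : 2 ^ (k + 2 + 1) = 8 * 2 ^ k := by ring
    simp at this
    omega
  exact ⟨hnot, hord⟩

theorem stmt_10 {K : Type*} [Field K] [CharP K 2]
    {G : Type*} [Group G] (n : ℕ) (hn : 3 ≤ n) (a b : G)
    (ha : a ^ 2 ^ n = 1) (hb : b ^ 2 = a ^ 2 ^ (n - 1))
    (hconj : b * a * b⁻¹ = a⁻¹)
    (hgen : Subgroup.closure {a, b} = (⊤ : Subgroup G))
    (hcard : Nat.card G = 2 ^ (n + 1)) :
    ¬ ∃ B : Set (MonoidAlgebra K G), IsFilteredMulBasis K B := by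
  rintro ⟨B, -, -, hmul, hli, hspan⟩
  obtain ⟨k, rfl⟩ : ∃ k, n = k + 2 := ⟨n - 2, by omega⟩
  have hk : 1 ≤ k := by omega
  have h4 : 2 ^ (k + 2) = 4 * 2 ^ k := by ring
  have h2 : 2 ^ (k + 2 - 1) = 2 * 2 ^ k := by
    rw [show k + 2 - 1 = k + 1 by omega]; ring
  rw [h4] at ha
  rw [h2] at hb
  have hN : 0 < 4 * 2 ^ k := by positivity
  have hba := quat_ba hconj
  have hpow := quat_pow hN ha
  have hcover := quat_cover hN ha hb hconj hgen
  obtain ⟨hnot, hord⟩ := quat_order hN ha hgen hcover hcard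
  let s : Subgroup.zpowers a := ⟨a, Subgroup.mem_zpowers a⟩
  have hs : orderOf s = 4 * 2 ^ k := by rw [← hord]; exact Subgroup.orderOf_mk a _
  have hgenH : ∀ h : Subgroup.zpowers a, ∃ i : ℕ, h = s ^ i := by
    rintro ⟨h, hh⟩
    obtain ⟨i, rfl⟩ := hpow h hh
    exact ⟨i, rfl⟩
  have hbj : ∀ h : Subgroup.zpowers a,
      b * (Subgroup.zpowers a).subtype h = (Subgroup.zpowers a).subtype h⁻¹ * b := by
    intro h
    obtain ⟨i, rfl⟩ := hgenH h
    exact hba i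
  have hbH : ∀ h : Subgroup.zpowers a, (Subgroup.zpowers a).subtype h ≠ b := by
    rintro ⟨h, hh⟩ rfl
    exact hnot hh
  have hG : ∀ x : G, ∃ h : Subgroup.zpowers a,
      x = (Subgroup.zpowers a).subtype h ∨ x = (Subgroup.zpowers a).subtype h * b := by
    intro x
    obtain ⟨i, hi⟩ := hcover x
    exact ⟨s ^ i, hi⟩
  have hcomm : ∀ x y : Subgroup.zpowers a, x * y = y * x := by
    intro x y
    obtain ⟨i, rfl⟩ := hgenH x
    obtain ⟨j, rfl⟩ := hgenH y
    rw [← pow_add, ← pow_add, add_comm]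
  have hbb : b * b = (Subgroup.zpowers a).subtype (s ^ (2 * 2 ^ k)) := by
    rw [← sq, hb, map_pow]
    congr 1
  exact no_filtered_of_comm hcomm hk hs hgenH (Subgroup.subtype_injective _) hbH hG hbj hbb ⟨B, hmul, hli, hspan⟩
end

section
/- Let K be a field of characteristic p > 2 and let G be a nonabelian finite metacyclic p-group. Then the group algebra KG has no filtered multiplicative K-basis. -/
namespace FMB

open MonoidAlgebra

variable (K : Type*) [Field K] (G : Type*) [Group G]

noncomputable def aug : MonoidAlgebra K G →ₐ[K] K := MonoidAlgebra.lift K K G 1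

noncomputable def J : Submodule K (MonoidAlgebra K G) := LinearMap.ker (aug K G).toLinearMap

variable {K G}

@[simp] lemma aug_of (g : G) : aug K G (of K G g) = 1 := by simp [aug]

lemma mem_J {x : MonoidAlgebra K G} : x ∈ J K G ↔ aug K G x = 0 := by simp [J]

lemma of_sub_one_mem (g : G) : of K G g - 1 ∈ J K G := by
  rw [mem_J, map_sub, aug_of, map_one, sub_self]

lemma mul_J {x y : MonoidAlgebra K G} (h : y ∈ J K G) : x * y ∈ J K G := by
  rw [mem_J] at *; rw [map_mul, h, mul_zero]

lemma J_mul {x y : MonoidAlgebra K G} (h : x ∈ J K G) : x * y ∈ J K G := by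
  rw [mem_J] at *; rw [map_mul, h, zero_mul]

lemma linext {M : Type*} [AddCommGroup M] [Module K M] {f g : MonoidAlgebra K G →ₗ[K] M}
    (h : ∀ x, f (of K G x) = g (of K G x)) : f = g := by
  ext x
  simpa using h x

lemma span_of : Submodule.span K (Set.range (of K G)) = ⊤ := by
  rw [eq_top_iff]
  rintro x -
  induction x using MonoidAlgebra.induction_on with
  | of g => exact Submodule.subset_span ⟨g, rfl⟩
  | add x y hx hy => exact add_mem hx hy
  | smul r x hx => exact Submodule.smul_mem _ _ hx

/-- `J` is spanned by the `g - 1`. -/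
lemma J_eq_span : J K G = Submodule.span K (Set.range fun g : G => of K G g - 1) := by
  apply le_antisymm
  · intro x hx
    have key : ∀ x : MonoidAlgebra K G, x - algebraMap K _ (aug K G x) ∈
        Submodule.span K (Set.range fun g : G => of K G g - 1) := by
      intro x
      induction x using MonoidAlgebra.induction_on with
      | of g => rw [aug_of, map_one]; exact Submodule.subset_span ⟨g, rfl⟩
      | add x y hx hy =>
        rw [map_add, map_add, add_sub_add_comm]; exact add_mem hx hy
      | smul r x hx =>
        have : r • x - algebraMap K (MonoidAlgebra K G) (aug K G (r • x)) =
            r • (x - algebraMap K _ (aug K G x)) := by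
          rw [map_smul, smul_sub, smul_eq_mul, map_mul, Algebra.smul_def r (algebraMap K _ _)]
        rw [this]; exact Submodule.smul_mem _ _ hx
    have := key x
    rwa [mem_J.1 hx, map_zero, sub_zero] at this
  · rw [Submodule.span_le]
    rintro _ ⟨g, rfl⟩
    exact of_sub_one_mem g

/-! ### products in degree two -/

/-- test homomorphism -/
noncomputable def testHom (f h : G → K) (hf : ∀ a b, f (a * b) = f a + f b)
    (hh : ∀ a b, h (a * b) = h a + h b) : MonoidAlgebra K G →ₐ[K] DualNumber (DualNumber K) :=
  MonoidAlgebra.lift K _ G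
    { toFun := fun g => TrivSqZeroExt.inl (TrivSqZeroExt.inl 1 + TrivSqZeroExt.inr (f g)) +
        TrivSqZeroExt.inr (TrivSqZeroExt.inl (h g) + TrivSqZeroExt.inr (h g * f g))
      map_one' := by
        have h1 : f 1 = 0 := by simpa using hf 1 1
        have h2 : h 1 = 0 := by simpa using hh 1 1
        simp [h1, h2]
      map_mul' := by
        intro a b
        rw [hf, hh]
        apply TrivSqZeroExt.ext
        · apply TrivSqZeroExt.ext
          · simp
          · simp; ring
        · apply TrivSqZeroExt.ext
          · simp; ring
          · simp; ring }

lemma not_mem_J3 (h2 : (2 : K) ≠ 0) {u v : MonoidAlgebra K G} (hu : u ∈ J K G) (hv : v ∈ J K G)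
    (hu2 : u ∉ J K G ^ 2) (hv2 : v ∉ J K G ^ 2) : u * v ∉ J K G ^ 3 := by
  intro huv
  obtain ⟨l, hlu, hl⟩ := Submodule.exists_le_ker_of_notMem hu2
  obtain ⟨m, hmv, hm⟩ := Submodule.exists_le_ker_of_notMem hv2
  have hom : ∀ l : MonoidAlgebra K G →ₗ[K] K, J K G ^ 2 ≤ LinearMap.ker l → ∀ a b : G,
      l (of K G (a * b)) - l 1 = (l (of K G a) - l 1) + (l (of K G b) - l 1) := by
    intro l hl a b
    have h1 : (of K G a - 1) * (of K G b - 1) ∈ J K G ^ 2 := by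
      rw [pow_two]; exact Submodule.mul_mem_mul (of_sub_one_mem a) (of_sub_one_mem b)
    have h3 := LinearMap.mem_ker.1 (hl h1)
    have e : (of K G a - 1) * (of K G b - 1) = of K G (a * b) - of K G a - of K G b + 1 := by
      rw [map_mul]; noncomm_ring
    rw [e, map_add, map_sub, map_sub] at h3
    linear_combination h3
  -- general facts on test homs
  have gen : ∀ l m : MonoidAlgebra K G →ₗ[K] K, J K G ^ 2 ≤ LinearMap.ker l →
      J K G ^ 2 ≤ LinearMap.ker m → l u * m v + m u * l v = 0 := by
    intro l m hl hm
    let T := testHom (fun g => l (of K G g) - l 1) (fun g => m (of K G g) - m 1)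
      (hom l hl) (hom m hm)
    have T00 : ∀ x ∈ J K G, (T x).fst.fst = 0 := by
      intro x hx
      rw [J_eq_span] at hx
      induction hx using Submodule.span_induction with
      | mem x hx =>
        obtain ⟨g, rfl⟩ := hx
        simp [T, testHom]
      | zero => simp
      | add x y _ _ hx hy => simp [hx, hy]
      | smul r x _ hx => simp [hx]
    have T10 : ∀ x ∈ J K G, (T x).fst.snd = l x := by
      intro x hx
      rw [J_eq_span] at hx
      induction hx using Submodule.span_induction with
      | mem x hx =>
        obtain ⟨g, rfl⟩ := hx
        simp [T, testHom]
      | zero => simp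
      | add x y _ _ hx hy => simp [hx, hy]
      | smul r x _ hx => simp [hx]
    have T01 : ∀ x ∈ J K G, (T x).snd.fst = m x := by
      intro x hx
      rw [J_eq_span] at hx
      induction hx using Submodule.span_induction with
      | mem x hx =>
        obtain ⟨g, rfl⟩ := hx
        simp [T, testHom]
      | zero => simp
      | add x y _ _ hx hy => simp [hx, hy]
      | smul r x _ hx => simp [hx]
    have T3 : ∀ x ∈ J K G ^ 3, (T x).snd.snd = 0 := by
      intro x hx
      rw [pow_succ, pow_two] at hx
      induction hx using Submodule.mul_induction_on' with
      | mem_mul_mem x hx z hz =>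
        induction hx using Submodule.mul_induction_on' with
        | mem_mul_mem x hx y hy => simp [T00 x hx, T00 y hy, T00 z hz]
        | add x _ y _ hx hy => rw [add_mul, map_add, TrivSqZeroExt.snd_add, TrivSqZeroExt.snd_add, hx, hy, add_zero]
      | add x _ y _ hx hy => simp [hx, hy]
    have := T3 _ huv
    simp only [map_mul, TrivSqZeroExt.snd_mul, TrivSqZeroExt.snd_add, smul_eq_mul, MulOpposite.smul_eq_mul_unop, MulOpposite.unop_op,
      T00 u hu, T00 v hv, T10 u hu, T10 v hv, T01 u hu, T01 v hv] at this
    linear_combination this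
  have e1 := gen l l hl hl
  have e2 := gen m m hm hm
  have e3 := gen l m hl hm
  have hlv : l v = 0 := by
    have : (2 * l u) * l v = 0 := by linear_combination e1
    exact (mul_eq_zero.1 this).resolve_left (mul_ne_zero h2 hlu)
  rw [hlv, mul_zero, add_zero] at e3
  exact (mul_ne_zero hlu hmv) e3

/-! ### the radical -/

lemma exists_fixed {p : ℕ} [Fact p.Prime] [CharP K p] [Finite G] (hpG : IsPGroup p G)
    {M : Type*} [AddCommGroup M] [Module (MonoidAlgebra K G) M] [Nontrivial M] :
    ∃ m : M, m ≠ 0 ∧ ∀ g : G, of K G g • m = m := by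
  obtain ⟨m0, hm0⟩ := exists_ne (0 : M)
  have hpM : ∀ m : M, p • m = 0 := by
    intro m
    have : ((p : ℕ) : MonoidAlgebra K G) = 0 := by
      rw [← map_natCast (algebraMap K (MonoidAlgebra K G)), CharP.cast_eq_zero, map_zero]
    rw [← Nat.cast_smul_eq_nsmul (MonoidAlgebra K G), this, zero_smul]
  let H : AddSubgroup M := AddSubgroup.closure (Set.range fun g : G => of K G g • m0)
  have hH : ∀ g : G, ∀ x ∈ H, of K G g • x ∈ H := by
    intro g x hx
    induction hx using AddSubgroup.closure_induction with
    | mem x hx =>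
      obtain ⟨k, rfl⟩ := hx
      apply AddSubgroup.subset_closure
      exact ⟨g * k, by simp only [map_mul, mul_smul]⟩
    | zero => rw [smul_zero]; exact zero_mem _
    | add x y _ _ hx hy => rw [smul_add]; exact add_mem hx hy
    | neg x _ hx => rw [smul_neg]; exact neg_mem hx
  let _ : MulAction G H :=
    { smul := fun g x => ⟨of K G g • (x : M), hH g x x.2⟩
      one_smul := fun x => Subtype.ext (by
        change of K G 1 • (x : M) = x
        rw [map_one, one_smul])
      mul_smul := fun g k x => Subtype.ext (by
        change of K G (g * k) • (x : M) = of K G g • of K G k • (x : M)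
        rw [map_mul, mul_smul]) }
  have hfg : AddGroup.FG H := by
    rw [AddGroup.fg_iff_addSubgroup_fg, AddSubgroup.fg_iff]
    exact ⟨_, rfl, Set.finite_range _⟩
  have hpH : ∀ x : H, p • x = 0 := fun x => Subtype.ext (by simpa using hpM x)
  have hp0 : 0 < p := (Fact.out : p.Prime).pos
  have hfin : Finite H := by
    apply AddCommGroup.finite_of_fg_isAddTorsion
    intro x
    exact isOfFinAddOrder_iff_nsmul_eq_zero.2 ⟨p, hp0, hpH x⟩
  have hm0H : m0 ∈ H := AddSubgroup.subset_closure ⟨1, by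
    change of K G 1 • m0 = m0
    rw [map_one, one_smul]⟩
  have hord : addOrderOf (⟨m0, hm0H⟩ : H) = p :=
    addOrderOf_eq_prime (hpH _) (fun h => hm0 (congrArg Subtype.val h))
  have hdvd : p ∣ Nat.card H := hord ▸ addOrderOf_dvd_natCard _
  obtain ⟨b, hb, hb0⟩ := hpG.exists_fixed_point_of_prime_dvd_card_of_fixed_point H hdvd
    (a := 0) (fun g => Subtype.ext (smul_zero (of K G g)))
  exact ⟨b, fun h => hb0 (Subtype.ext h.symm), fun g => congrArg Subtype.val (hb g)⟩

lemma rad_eq {p : ℕ} [Fact p.Prime] [CharP K p] [Finite G] (hpG : IsPGroup p G) :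
    Submodule.restrictScalars K (ringRad (MonoidAlgebra K G)) = J K G := by
  apply le_antisymm
  · intro x hx
    rw [mem_J]
    by_contra h
    have hx' : x ∈ Ideal.jacobson (⊥ : Ideal (MonoidAlgebra K G)) := hx
    obtain ⟨z, hz⟩ := Ideal.mem_jacobson_iff.1 hx' (algebraMap K _ (-(aug K G x)⁻¹))
    have := congrArg (aug K G) ((Submodule.mem_bot _).1 hz)
    rw [map_sub, map_add, map_mul, map_mul, AlgHom.commutes, map_one, map_zero] at this
    rw [Algebra.algebraMap_self_apply, mul_assoc, neg_mul, inv_mul_cancel₀ h] at this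
    simp at this
  · intro x hx
    change x ∈ Ideal.jacobson (⊥ : Ideal (MonoidAlgebra K G))
    rw [Ideal.jacobson, Ideal.mem_sInf]
    rintro m ⟨-, hm⟩
    have : Nontrivial (MonoidAlgebra K G ⧸ m) := Submodule.Quotient.nontrivial_iff.2 hm.ne_top
    obtain ⟨q, hq0, hq⟩ := exists_fixed (K := K) hpG (M := MonoidAlgebra K G ⧸ m)
    obtain ⟨a, rfl⟩ := Submodule.Quotient.mk_surjective m q
    have hJa : ∀ x ∈ J K G, x * a ∈ m := by
      intro x hx
      rw [J_eq_span] at hx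
      induction hx using Submodule.span_induction with
      | mem x hx =>
        obtain ⟨g, rfl⟩ := hx
        have := hq g
        rw [← Submodule.Quotient.mk_smul, Submodule.Quotient.eq] at this
        simpa [sub_mul] using this
      | zero => simp
      | add x y _ _ hx hy => rw [add_mul]; exact add_mem hx hy
      | smul r x _ hx =>
        rw [Algebra.smul_def, mul_assoc]; exact Ideal.mul_mem_left _ _ hx
    have ha : a ∉ m := fun h => hq0 ((Submodule.Quotient.mk_eq_zero _).2 h)
    obtain ⟨y, i, hi, hy⟩ := hm.exists_inv ha
    have : x = x * y * a + x * i := by rw [mul_assoc, ← mul_add, hy, mul_one]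
    rw [this]
    exact add_mem (hJa _ (J_mul hx)) (Ideal.mul_mem_left _ _ hi)

lemma J_nilpotent {p : ℕ} [Fact p.Prime] [CharP K p] [Finite G] (hpG : IsPGroup p G) :
    ∃ n, J K G ^ n = ⊥ := by
  have : Module.Finite K (MonoidAlgebra K G) := by infer_instance
  have : IsArtinianRing (MonoidAlgebra K G) := IsArtinianRing.of_finite K _
  obtain ⟨n, hn⟩ := IsArtinianRing.isNilpotent_jacobson_bot (R := MonoidAlgebra K G)
  have hle : ∀ n, J K G ^ (n + 1) ≤ Submodule.restrictScalars K (ringRad (MonoidAlgebra K G) ^ (n + 1)) := by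
    intro n
    induction n with
    | zero => rw [zero_add, pow_one, Submodule.pow_one, rad_eq hpG]
    | succ n ih =>
      rw [pow_succ, Submodule.mul_le]
      intro x hx y hy
      rw [← rad_eq hpG] at hy
      change x * y ∈ ringRad (MonoidAlgebra K G) ^ (n + 1 + 1)
      rw [Submodule.pow_succ]
      exact Submodule.mul_mem_mul (ih hx) hy
  refine ⟨n + 1, ?_⟩
  rw [eq_bot_iff]
  refine (hle n).trans ?_
  have : ringRad (MonoidAlgebra K G) ^ (n + 1) = ⊥ := by
    rw [Submodule.pow_succ, ringRad, hn]
    exact Submodule.bot_mul _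
  rw [this]
  simp

/-! ### the group theory -/

/-- dimension subgroup-like: elements `g` with `g - 1 ∈ J ^ 3` -/
lemma mul_Jn {n : ℕ} {x y : MonoidAlgebra K G} (h : y ∈ J K G ^ (n + 1)) :
    x * y ∈ J K G ^ (n + 1) := by
  rw [pow_succ'] at *
  induction h using Submodule.mul_induction_on' with
  | mem_mul_mem a ha b hb => rw [← mul_assoc]; exact Submodule.mul_mem_mul (mul_J ha) hb
  | add a _ b _ ha hb => rw [mul_add]; exact add_mem ha hb

lemma Jn_mul {n : ℕ} {x y : MonoidAlgebra K G} (h : x ∈ J K G ^ (n + 1)) :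
    x * y ∈ J K G ^ (n + 1) := by
  rw [pow_succ] at *
  induction h using Submodule.mul_induction_on' with
  | mem_mul_mem a ha b hb => rw [mul_assoc]; exact Submodule.mul_mem_mul ha (J_mul hb)
  | add a _ b _ ha hb => rw [add_mul]; exact add_mem ha hb

variable (K G) in
noncomputable def D3 : Subgroup G where
  carrier := {g | of K G g - 1 ∈ J K G ^ 3}
  one_mem' := by
    change of K G 1 - 1 ∈ J K G ^ 3
    rw [map_one, sub_self]; exact zero_mem _
  mul_mem' := by
    intro a b ha hb
    have : of K G (a * b) - 1 = of K G a * (of K G b - 1) + (of K G a - 1) := by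
      rw [map_mul]; noncomm_ring
    change of K G (a * b) - 1 ∈ J K G ^ 3
    rw [this]
    exact add_mem (mul_Jn hb) ha
  inv_mem' := by
    intro a ha
    have : of K G a⁻¹ - 1 = - (of K G a⁻¹ * (of K G a - 1)) := by
      rw [mul_sub, ← map_mul, inv_mul_cancel, map_one, mul_one, neg_sub]
    change of K G a⁻¹ - 1 ∈ J K G ^ 3
    rw [this]
    exact neg_mem (mul_Jn ha)

instance : (D3 K G).Normal where
  conj_mem := by
    intro n hn g
    have : of K G (g * n * g⁻¹) - 1 = of K G g * (of K G n - 1) * of K G g⁻¹ := by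
      rw [mul_sub, sub_mul, mul_one, ← map_mul, ← map_mul, ← map_mul, mul_inv_cancel, map_one]
    change of K G (g * n * g⁻¹) - 1 ∈ J K G ^ 3
    rw [this]
    exact Jn_mul (mul_Jn hn)

lemma pow_mem_D3 {p : ℕ} [Fact p.Prime] [CharP K p] (hp : 2 < p) (g : G) : g ^ p ∈ D3 K G := by
  change of K G (g ^ p) - 1 ∈ J K G ^ 3
  have : CharP (MonoidAlgebra K G) p := charP_of_injective_algebraMap
    (algebraMap K (MonoidAlgebra K G)).injective p
  have e : of K G (g ^ p) - 1 = (of K G g - 1) ^ p := by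
    rw [sub_pow_char_of_commute _ (Commute.one_right _), map_pow, one_pow]
  rw [e]
  obtain ⟨k, rfl⟩ := Nat.exists_eq_add_of_lt hp
  rw [show 2 + k + 1 = k + 3 by ring, pow_add]
  exact mul_Jn (Submodule.pow_mem_pow _ (of_sub_one_mem g) 3)

lemma conj_mem_D3 {p : ℕ} [Fact p.Prime] [CharP K p] (hp : 2 < p) [Finite G] (hpG : IsPGroup p G)
    (N : Subgroup G) [hN : N.Normal] [IsCyclic N] (n : G) (hn : n ∈ N) (g : G) :
    g * n * g⁻¹ * n⁻¹ ∈ D3 K G := by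
  obtain ⟨⟨a, haN⟩, ha⟩ := IsCyclic.exists_generator (α := N)
  have ha' : ∀ x ∈ N, ∃ r : ℤ, a ^ r = x := by
    intro x hx
    obtain ⟨r, hr⟩ := Subgroup.mem_zpowers_iff.1 (ha ⟨x, hx⟩)
    exact ⟨r, by simpa using congrArg Subtype.val hr⟩
  obtain ⟨r, hr⟩ := ha' _ (hN.conj_mem a haN g)
  have hconj : ∀ j : ℤ, g * a ^ j * g⁻¹ = a ^ (r * j) := by
    intro j
    rw [← conj_zpow, ← hr, ← zpow_mul]
  have hiter : ∀ k : ℕ, g ^ k * a * (g ^ k)⁻¹ = a ^ (r ^ k) := by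
    intro k
    induction k with
    | zero => simp
    | succ k ih =>
      have : g ^ (k + 1) * a * (g ^ (k + 1))⁻¹ = g * (g ^ k * a * (g ^ k)⁻¹) * g⁻¹ := by
        rw [pow_succ']; group
      rw [this, ih, hconj, pow_succ']
  obtain ⟨j, rfl⟩ := ha' n hn
  rw [hconj, ← zpow_neg, ← zpow_add]
  by_cases ha1 : a = 1
  · rw [ha1, one_zpow]; exact one_mem _
  obtain ⟨k, hk⟩ := hpG g
  have h1 := hiter (p ^ k)
  rw [hk, one_mul, inv_one, mul_one] at h1
  have hdvd : (orderOf a : ℤ) ∣ r ^ p ^ k - 1 := by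
    rw [orderOf_dvd_iff_zpow_eq_one, zpow_sub, ← h1, zpow_one, mul_inv_cancel]
  have hpa : p ∣ orderOf a := by
    exact hpG.dvd_orderOf ha1
  have hpr : (p : ℤ) ∣ r - 1 := by
    have h2 := (Int.natCast_dvd_natCast.2 hpa).trans hdvd
    rw [← ZMod.intCast_zmod_eq_zero_iff_dvd] at h2 ⊢
    push_cast at h2 ⊢
    rwa [ZMod.pow_card_pow] at h2
  obtain ⟨c, hc⟩ := hpr
  have : r * j + -j = p * (c * j) := by linear_combination j * hc
  rw [this, zpow_mul, zpow_natCast]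
  exact zpow_mem (pow_mem_D3 hp a) _

lemma comm_mod_D3 {p : ℕ} [Fact p.Prime] [CharP K p] (hp : 2 < p) [Finite G] (hpG : IsPGroup p G)
    (N : Subgroup G) [hN : N.Normal] [IsCyclic N] [hQ : IsCyclic (G ⧸ N)] (g h : G) :
    (QuotientGroup.mk (g * h) : G ⧸ D3 K G) = QuotientGroup.mk (h * g) := by
  let P := N ⊔ D3 K G
  let f : G ⧸ D3 K G →* G ⧸ P := QuotientGroup.map _ _ (MonoidHom.id G) (by
    intro x hx; exact (le_sup_right : D3 K G ≤ P) hx)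
  let f' : G ⧸ N →* G ⧸ P := QuotientGroup.map _ _ (MonoidHom.id G) (by
    intro x hx; exact (le_sup_left : N ≤ P) hx)
  have : IsCyclic (G ⧸ P) := isCyclic_of_surjective f' (by
    intro x
    obtain ⟨x, rfl⟩ := QuotientGroup.mk_surjective x
    exact ⟨x, rfl⟩)
  have hf : f.ker ≤ Subgroup.center _ := by
    intro x hx
    obtain ⟨x, rfl⟩ := QuotientGroup.mk_surjective x
    have hxP : x ∈ P := (QuotientGroup.eq_one_iff x).1 hx
    obtain ⟨n, hn, d, hd, rfl⟩ := Subgroup.mem_sup_of_normal_left.1 hxP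
    rw [Subgroup.mem_center_iff]
    intro y
    obtain ⟨y, rfl⟩ := QuotientGroup.mk_surjective y
    have e : (QuotientGroup.mk (n * d) : G ⧸ D3 K G) = QuotientGroup.mk n := by
      rw [QuotientGroup.mk_mul_of_mem n hd]
    rw [e, ← QuotientGroup.mk_mul, ← QuotientGroup.mk_mul]
    have := conj_mem_D3 (K := K) hp hpG N n hn y
    rw [← QuotientGroup.eq_one_iff] at this
    simp only [QuotientGroup.mk_mul, QuotientGroup.mk_inv] at this ⊢
    rw [mul_inv_eq_one, mul_inv_eq_iff_eq_mul] at this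
    exact this
  have hc := (f.isMulCommutative_of_isCyclic_of_ker_le_center hf).is_comm.comm
    (QuotientGroup.mk g) (QuotientGroup.mk h)
  exact hc

lemma commutator_mem_J3 {p : ℕ} [Fact p.Prime] [CharP K p] (hp : 2 < p) [Finite G]
    (hpG : IsPGroup p G)
    (N : Subgroup G) [hN : N.Normal] [IsCyclic N] [hQ : IsCyclic (G ⧸ N)]
    (x y : MonoidAlgebra K G) : x * y - y * x ∈ J K G ^ 3 := by
  induction x using MonoidAlgebra.induction_on with
  | of g =>
    induction y using MonoidAlgebra.induction_on with
    | of h =>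
      have h1 := QuotientGroup.eq.1 (comm_mod_D3 (K := K) hp hpG N h g)
      change of K G _ - 1 ∈ J K G ^ 3 at h1
      have := mul_Jn (x := of K G (h * g)) h1
      rw [mul_sub, ← map_mul, mul_inv_cancel_left, mul_one, map_mul, map_mul] at this
      exact this
    | add a b ha hb =>
      rw [mul_add, add_mul, add_sub_add_comm]; exact add_mem ha hb
    | smul r a ha =>
      rw [mul_smul_comm, smul_mul_assoc, ← smul_sub]; exact Submodule.smul_mem _ _ ha
  | add a b ha hb =>
    rw [mul_add, add_mul, add_sub_add_comm]; exact add_mem ha hb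
  | smul r a ha =>
    rw [mul_smul_comm, smul_mul_assoc, ← smul_sub]; exact Submodule.smul_mem _ _ ha

/-! ### the main argument -/

lemma span_inter_pow {A : Type*} [Ring A] [Algebra K A] {B : Set A} {I : Submodule K A}
    (hB : ∀ b₁ ∈ B, ∀ b₂ ∈ B, b₁ * b₂ = 0 ∨ b₁ * b₂ ∈ B)
    (hI : I ≤ Submodule.span K (B ∩ I)) (n : ℕ) :
    I ^ (n + 1) ≤ Submodule.span K (B ∩ (I ^ (n + 1) : Submodule K A)) := by
  induction n with
  | zero => simpa using hI
  | succ n ih =>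
    calc I ^ (n + 1 + 1) = I ^ (n + 1) * I := pow_succ _ _
      _ ≤ Submodule.span K (B ∩ (I ^ (n + 1) : Submodule K A)) * Submodule.span K (B ∩ I) :=
        mul_le_mul' ih hI
      _ ≤ _ := by
        rw [Submodule.span_mul_span, Submodule.span_le]
        rintro _ ⟨x, ⟨hxB, hx⟩, y, ⟨hyB, hy⟩, rfl⟩
        change x * y ∈ _
        rcases hB x hxB y hyB with h | h
        · rw [h]; exact zero_mem _
        · refine Submodule.subset_span ⟨h, ?_⟩
          change x * y ∈ I ^ (n + 1 + 1)
          rw [pow_succ]; exact Submodule.mul_mem_mul hx hy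

theorem main {K : Type*} [Field K] {p : ℕ} [Fact p.Prime] [CharP K p] (hp : 2 < p)
    {G : Type*} [Group G] [Finite G] (hpG : IsPGroup p G)
    (hmeta : ∃ N : Subgroup G, ∃ _hN : N.Normal, IsCyclic N ∧ (letI := _hN; IsCyclic (G ⧸ N)))
    (hnab : ¬ ∀ x y : G, x * y = y * x) :
    ¬ ∃ B : Set (MonoidAlgebra K G), IsFilteredMulBasis K B := by
  rintro ⟨B, hli, -, hmul, -, hspan⟩
  obtain ⟨N, hN, hNc, hQ⟩ := hmeta
  have hcomm := commutator_mem_J3 (K := K) hp hpG N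
  have hrad := rad_eq (K := K) hpG
  have hset : (ringRad (MonoidAlgebra K G) : Set (MonoidAlgebra K G)) = J K G := by
    rw [← hrad]; rfl
  rw [hset, hrad] at hspan
  have hpow := span_inter_pow hmul hspan.ge
  have h2 : (2 : K) ≠ 0 := by
    intro h
    have : p ∣ 2 := (CharP.cast_eq_zero_iff K p 2).1 (by exact_mod_cast h)
    exact absurd (Nat.le_of_dvd two_pos this) (by omega)
  let S : Set (MonoidAlgebra K G) := {b | b ∈ B ∧ b ∈ J K G ∧ b ∉ J K G ^ 2}
  have hS : ∀ u ∈ S, ∀ v ∈ S, u * v = v * u := by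
    rintro u ⟨huB, hu, hu2⟩ v ⟨hvB, hv, hv2⟩
    have huv := not_mem_J3 h2 hu hv hu2 hv2
    have hvu := not_mem_J3 h2 hv hu hv2 hu2
    have huvB := (hmul u huB v hvB).resolve_left (fun h => huv (h ▸ zero_mem _))
    have hvuB := (hmul v hvB u huB).resolve_left (fun h => hvu (h ▸ zero_mem _))
    by_contra hne
    have hd : u * v - v * u ∈ Submodule.span K (B ∩ (J K G ^ 3 : Submodule K _)) :=
      hpow 2 (hcomm u v)
    have hmem : u * v ∈ Submodule.span K
        (((↑) : B → MonoidAlgebra K G) '' {b | (b : MonoidAlgebra K G) ≠ u * v}) := by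
      have h1 : v * u ∈ Submodule.span K
          (((↑) : B → MonoidAlgebra K G) '' {b | (b : MonoidAlgebra K G) ≠ u * v}) :=
        Submodule.subset_span ⟨⟨_, hvuB⟩, fun h => hne h.symm, rfl⟩
      have hle : B ∩ (J K G ^ 3 : Submodule K _) ⊆
          (((↑) : B → MonoidAlgebra K G) '' {b | (b : MonoidAlgebra K G) ≠ u * v}) := by
        rintro b ⟨hb, hb3⟩
        refine ⟨⟨b, hb⟩, ?_, rfl⟩
        rintro rfl
        exact huv hb3
      have h3 := add_mem (Submodule.span_mono hle hd) h1
      rwa [sub_add_cancel] at h3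
    exact hli.notMem_span_image (s := {b | (b : MonoidAlgebra K G) ≠ u * v})
      (x := ⟨_, huvB⟩) (fun h => h rfl) hmem
  have hJ1 : J K G ≤ Submodule.span K S ⊔ J K G ^ 2 := by
    conv_lhs => rw [← hspan]
    rw [Submodule.span_le]
    rintro b ⟨hb, hbJ⟩
    by_cases h : b ∈ J K G ^ 2
    · exact Submodule.mem_sup_right h
    · exact Submodule.mem_sup_left (Submodule.subset_span ⟨hb, hbJ, h⟩)
  let C : Submodule K (MonoidAlgebra K G) := Subalgebra.toSubmodule (Algebra.adjoin K S)
  have hSJ : Submodule.span K S ≤ J K G := Submodule.span_le.2 fun b hb => hb.2.1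
  have hstep : ∀ n, J K G ^ (n + 1) ≤ Submodule.span K S ^ (n + 1) ⊔ J K G ^ (n + 2) := by
    intro n
    induction n with
    | zero => simpa using hJ1
    | succ n ih =>
      rw [pow_succ, Submodule.mul_le]
      intro x hx y hy
      obtain ⟨x1, hx1, x2, hx2, rfl⟩ := Submodule.mem_sup.1 (ih hx)
      obtain ⟨y1, hy1, y2, hy2, rfl⟩ := Submodule.mem_sup.1 (hJ1 hy)
      have hx1J : x1 ∈ J K G ^ (n + 1) := (pow_le_pow_left' hSJ (n + 1)) hx1
      have : (x1 + x2) * (y1 + y2) = x1 * y1 + (x1 * y2 + x2 * (y1 + y2)) := by noncomm_ring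
      rw [this]
      refine Submodule.add_mem_sup ?_ (add_mem ?_ ?_)
      · rw [pow_succ]; exact Submodule.mul_mem_mul hx1 hy1
      · rw [show n + 1 + 2 = (n + 1) + 2 from rfl, pow_add]; exact Submodule.mul_mem_mul hx1J hy2
      · rw [show n + 1 + 2 = (n + 2) + 1 by ring, pow_succ]; exact Submodule.mul_mem_mul hx2 hy
  have hSC : ∀ n, Submodule.span K S ^ (n + 1) ≤ C := by
    intro n
    induction n with
    | zero =>
      rw [zero_add, pow_one]; exact Submodule.span_le.2 Algebra.subset_adjoin
    | succ n ih =>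
      rw [pow_succ, Submodule.mul_le]
      intro x hx y hy
      have hyC : y ∈ C := (Submodule.span_le (p := C)).2 Algebra.subset_adjoin hy
      exact (Algebra.adjoin K S).mul_mem (ih hx) hyC
  have hJC : ∀ n, J K G ≤ C ⊔ J K G ^ (n + 1) := by
    intro n
    induction n with
    | zero => simp
    | succ n ih =>
      refine ih.trans (sup_le le_sup_left ((hstep n).trans ?_))
      exact sup_le_sup_right (hSC n) _
  obtain ⟨n, hn⟩ := J_nilpotent (K := K) hpG
  have hJC' : J K G ≤ C := by
    have := hJC n
    rwa [pow_succ, hn, Submodule.bot_mul, sup_bot_eq] at this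
  have hall : ∀ x : MonoidAlgebra K G, x ∈ Algebra.adjoin K S := by
    intro x
    have h1 : x - algebraMap K _ (aug K G x) ∈ J K G := by
      rw [mem_J, map_sub, AlgHom.commutes, Algebra.algebraMap_self_apply, sub_self]
    have := (Algebra.adjoin K S).add_mem (hJC' h1) ((Algebra.adjoin K S).algebraMap_mem (aug K G x))
    rwa [sub_add_cancel] at this
  apply hnab
  intro x y
  have := Algebra.isMulCommutative_adjoin K hS
  have hxy := setLike_mul_comm (hall (of K G x)) (hall (of K G y))
  rw [← map_mul, ← map_mul] at hxy
  exact of_injective hxy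

end FMB

theorem stmt_11 {K : Type*} [Field K] {p : ℕ} [Fact p.Prime] [CharP K p] (hp : 2 < p)
    {G : Type*} [Group G] [Finite G] (hpG : IsPGroup p G)
    (hmeta : ∃ N : Subgroup G, ∃ _hN : N.Normal, IsCyclic N ∧ (letI := _hN; IsCyclic (G ⧸ N)))
    (hnab : ¬ ∀ x y : G, x * y = y * x) :
    ¬ ∃ B : Set (MonoidAlgebra K G), IsFilteredMulBasis K B := by
  exact FMB.main hp hpG hmeta hnab
end
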